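/- arXiv:2407.21046 — 7 statements merged into one kernel-verified Lean document; each statement's English description precedes it below -/
import Mathlib

section
/- Generalized information matrix equality (non-adaptive masking): Under the smoothness and realizability assumptions, the Hessian of the weighted pseudolikelihood loss at the true parameter equals the covariance matrix of the negative score of the masked conditional, i.e. ∇²_θ L_PL(θ*) = Cov_{X∼p_X, K∼p_K}( −∇_θ log p_θ(X_K | X_{−K}) )|_{θ=θ*} = E_{X∼p_X, K∼p_K}[ ∇_θ log p_θ(X_K|X_{−K}) · ∇_θ log p_θ(X_K|X_{−K})ᵀ ]|_{θ=θ*}. -/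
open scoped Classical BigOperators

noncomputable section

/-- Partial derivative of `f : ℝ^d → ℝ` along the `i`-th coordinate at `θ`. -/
def pderivAt {d : ℕ} (i : Fin d) (f : (Fin d → ℝ) → ℝ) (θ : Fin d → ℝ) : ℝ :=
  fderiv ℝ f θ (Pi.single i 1)

/-- Hessian matrix of `f : ℝ^d → ℝ` at `θ`. -/
def hessAt {d : ℕ} (f : (Fin d → ℝ) → ℝ) (θ : Fin d → ℝ) : Matrix (Fin d) (Fin d) ℝ :=
  Matrix.of fun i j => pderivAt i (fun θ' => pderivAt j f θ') θ

/-- The conditional probability `q(x_K | x_{-K})` of a distribution `q` on `Ω^N`: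
`q(x)` divided by the `q`-mass of all sequences agreeing with `x` outside `K`. -/
def condProb {Ω : Type*} [Fintype Ω] {N : ℕ} (q : (Fin N → Ω) → ℝ)
    (x : Fin N → Ω) (K : Finset (Fin N)) : ℝ :=
  q x / ∑ y : Fin N → Ω, (if ∀ i ∉ K, y i = x i then q y else 0)

lemma aux_info {ι : Type*} [Fintype ι] {d : ℕ} (Θ : Set (Fin d → ℝ)) (hΘ : IsOpen Θ)
    (θs : Fin d → ℝ) (hθs : θs ∈ Θ) (W : ι → ℝ) (c : ι → (Fin d → ℝ) → ℝ)
    (hc : ∀ a θ, 0 < c a θ) (hs : ∀ a, ContDiffOn ℝ 2 (c a) Θ)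
    (hconst : ∀ θ, ∑ a, W a * c a θ = 1) :
    (∀ i, ∑ a, W a * c a θs * pderivAt i (fun θ => Real.log (c a θ)) θs = 0) ∧
    ∀ i j, pderivAt i (fun θ' => pderivAt j
        (fun θ => ∑ a, W a * c a θs * (-(Real.log (c a θ)))) θ') θs
      = ∑ a, W a * c a θs * (pderivAt i (fun θ => Real.log (c a θ)) θs
          * pderivAt j (fun θ => Real.log (c a θ)) θs) := by
  have hd : ∀ a, ∀ θ ∈ Θ, DifferentiableAt ℝ (c a) θ := fun a θ hθ =>
    (((hs a).contDiffAt (hΘ.mem_nhds hθ)).differentiableAt (by norm_num))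
  have hd2 : ∀ a j, DifferentiableAt ℝ (fun θ => pderivAt j (c a) θ) θs := by
    intro a j
    have h1 : ContDiffAt ℝ 1 (fderiv ℝ (c a)) θs :=
      ((hs a).contDiffAt (hΘ.mem_nhds hθs)).fderiv_right (by norm_num)
    exact (h1.differentiableAt (by norm_num)).clm_apply (differentiableAt_const _)
  have hlog : ∀ a j, ∀ θ ∈ Θ, pderivAt j (fun θ => Real.log (c a θ)) θ
      = pderivAt j (c a) θ / c a θ := by
    intro a j θ hθ
    unfold pderivAt
    rw [((hd a θ hθ).hasFDerivAt.log (hc a θ).ne').fderiv]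
    simp [div_eq_inv_mul]
  have hz : ∀ j, ∀ θ ∈ Θ, ∑ a, W a * pderivAt j (c a) θ = 0 := by
    intro j θ hθ
    have h1 : HasFDerivAt (fun θ => ∑ a, W a * c a θ) (∑ a, W a • fderiv ℝ (c a) θ) θ :=
      HasFDerivAt.fun_sum fun a _ => (hd a θ hθ).hasFDerivAt.const_mul (W a)
    have h2 : (fun θ => ∑ a, W a * c a θ) = fun _ => (1:ℝ) := funext hconst
    rw [h2] at h1
    have h3 := h1.unique (hasFDerivAt_const (1:ℝ) θ)
    have h4 := congrArg (fun f => f (Pi.single j 1)) h3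
    simpa [pderivAt] using h4
  have hz2 : ∀ i j, ∑ a, W a * pderivAt i (fun θ => pderivAt j (c a) θ) θs = 0 := by
    intro i j
    have h1 : HasFDerivAt (fun θ => ∑ a, W a * pderivAt j (c a) θ)
        (∑ a, W a • fderiv ℝ (fun θ => pderivAt j (c a) θ) θs) θs :=
      HasFDerivAt.fun_sum fun a _ => (hd2 a j).hasFDerivAt.const_mul (W a)
    have h2 : (fun θ => ∑ a, W a * pderivAt j (c a) θ) =ᶠ[nhds θs] fun _ => (0:ℝ) := by
      filter_upwards [hΘ.mem_nhds hθs] with θ hθ using hz j θ hθ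
    have h3 := h1.unique ((hasFDerivAt_const (0:ℝ) θs).congr_of_eventuallyEq h2)
    have h4 := congrArg (fun f => f (Pi.single i 1)) h3
    simpa [pderivAt] using h4
  refine ⟨fun i => ?_, fun i j => ?_⟩
  · rw [← hz i θs hθs]
    refine Finset.sum_congr rfl fun a _ => ?_
    rw [hlog a i θs hθs]
    have := (hc a θs).ne'
    field_simp
  · have h1 : (fun θ' => pderivAt j (fun θ => ∑ a, W a * c a θs * (-(Real.log (c a θ)))) θ')
        =ᶠ[nhds θs] fun θ => ∑ a, -(W a * c a θs) * (pderivAt j (c a) θ * (c a θ)⁻¹) := by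
      filter_upwards [hΘ.mem_nhds hθs] with θ hθ
      have h1 : HasFDerivAt (fun θ => ∑ a, W a * c a θs * (-(Real.log (c a θ))))
          (∑ a, (W a * c a θs) • (-((c a θ)⁻¹ • fderiv ℝ (c a) θ))) θ :=
        HasFDerivAt.fun_sum fun a _ =>
          (((hd a θ hθ).hasFDerivAt.log (hc a θ).ne').fun_neg.const_mul (W a * c a θs))
      unfold pderivAt
      rw [h1.fderiv]
      simp only [ContinuousLinearMap.sum_apply, ContinuousLinearMap.smul_apply,
        ContinuousLinearMap.neg_apply, smul_eq_mul]
      exact Finset.sum_congr rfl fun a _ => by ring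
    have h2 : HasFDerivAt (fun θ => ∑ a, -(W a * c a θs) * (pderivAt j (c a) θ * (c a θ)⁻¹))
        (∑ a, (-(W a * c a θs)) • (pderivAt j (c a) θs • (-(c a θs ^ 2)⁻¹ • fderiv ℝ (c a) θs)
          + (c a θs)⁻¹ • fderiv ℝ (fun θ => pderivAt j (c a) θ) θs)) θs :=
      HasFDerivAt.fun_sum fun a _ =>
        (((hd2 a j).hasFDerivAt.mul
          ((hasDerivAt_inv (hc a θs).ne').comp_hasFDerivAt θs (hd a θs hθs).hasFDerivAt)).const_mul _)
    have h3 : pderivAt i (fun θ' => pderivAt j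
        (fun θ => ∑ a, W a * c a θs * (-(Real.log (c a θ)))) θ') θs
        = ∑ a, (-(W a * c a θs)) * (pderivAt j (c a) θs * (-(c a θs ^ 2)⁻¹ * pderivAt i (c a) θs)
          + (c a θs)⁻¹ * pderivAt i (fun θ => pderivAt j (c a) θ) θs) := by
      conv_lhs => unfold pderivAt
      have := (h2.congr_of_eventuallyEq h1).fderiv
      unfold pderivAt at this ⊢
      rw [this]
      simp only [ContinuousLinearMap.sum_apply, ContinuousLinearMap.smul_apply,
        ContinuousLinearMap.add_apply, smul_eq_mul]
    rw [h3, ← sub_eq_zero, ← neg_eq_zero.mpr (hz2 i j), ← Finset.sum_sub_distrib,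
      ← Finset.sum_neg_distrib]
    refine Finset.sum_congr rfl fun a _ => ?_
    rw [hlog a i θs hθs, hlog a j θs hθs]
    have := (hc a θs).ne'
    field_simp
    ring

/-- **Generalized information matrix equality (non-adaptive masking).**
Under smoothness and realizability, the Hessian of the weighted pseudolikelihood loss at the
true parameter `θ*` equals the covariance matrix of the negative score of the masked
conditional, which in turn equals the second moment matrix of the score. -/
theorem generalized_information_matrix_equality
    {Ω : Type*} [Fintype Ω] {N d : ℕ}
    -- the data distribution pX on Ω^N
    (pX : (Fin N → Ω) → ℝ) (hpX0 : ∀ x, 0 ≤ pX x) (hpX1 : ∑ x, pX x = 1)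
    -- the mask distribution pK on subsets of [N], independent of X
    (pK : Finset (Fin N) → ℝ) (hpK0 : ∀ K, 0 ≤ pK K)
    (hpK1 : ∑ K : Finset (Fin N), pK K = 1)
    -- an open parameter set Θ ⊆ ℝ^d
    (Θ : Set (Fin d → ℝ)) (hΘ : IsOpen Θ)
    -- a parametric family of strictly positive distributions, C² in θ
    (p : (Fin d → ℝ) → (Fin N → Ω) → ℝ)
    (hpos : ∀ θ x, 0 < p θ x) (hsum : ∀ θ, ∑ x, p θ x = 1)
    (hsmooth : ∀ x, ContDiffOn ℝ 2 (fun θ => p θ x) Θ)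
    -- realizability: p_{θ*} = pX at some θ* ∈ Θ
    (θs : Fin d → ℝ) (hθs : θs ∈ Θ) (hreal : p θs = pX)
    -- the weighted pseudolikelihood loss
    (L : (Fin d → ℝ) → ℝ)
    (hL : ∀ θ, L θ = ∑ x, ∑ K : Finset (Fin N),
      pX x * pK K * (-(Real.log (condProb (p θ) x K))))
    -- the score ∇_θ log p_θ(x_K | x_{-K}) evaluated at θ*
    (score : (Fin N → Ω) → Finset (Fin N) → Fin d → ℝ)
    (hscore : ∀ x K i, score x K i
      = pderivAt i (fun θ => Real.log (condProb (p θ) x K)) θs) :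
    -- ∇²L(θ*) = Cov(-∇ log p_θ(X_K|X_{-K}))|_{θ*}
    hessAt L θs
      = Matrix.of (fun i j =>
          (∑ x, ∑ K : Finset (Fin N),
              pX x * pK K * ((-(score x K i)) * (-(score x K j))))
          - (∑ x, ∑ K : Finset (Fin N), pX x * pK K * (-(score x K i)))
            * (∑ x, ∑ K : Finset (Fin N), pX x * pK K * (-(score x K j))))
    ∧
    -- and it equals E[∇ log p_θ(X_K|X_{-K}) ∇ log p_θ(X_K|X_{-K})ᵀ]|_{θ*}
    hessAt L θs
      = Matrix.of (fun i j =>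
          ∑ x, ∑ K : Finset (Fin N), pX x * pK K * (score x K i * score x K j)) := by
  set m : (Fin d → ℝ) → (Fin N → Ω) → Finset (Fin N) → ℝ := fun θ x K =>
    ∑ y : Fin N → Ω, (if ∀ i ∉ K, y i = x i then p θ y else 0) with hm
  have hcm : ∀ θ x K, condProb (p θ) x K = p θ x / m θ x K := fun θ x K => rfl
  have hmpos : ∀ θ x K, 0 < m θ x K := by
    intro θ x K
    refine Finset.sum_pos' (fun y _ => ?_) ⟨x, Finset.mem_univ _, ?_⟩
    · split_ifs
      · exact (hpos θ y).le
      · exact le_rfl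
    · rw [if_pos (fun _ _ => rfl)]
      exact hpos θ x
  have hmsm : ∀ x K, ContDiffOn ℝ 2 (fun θ => m θ x K) Θ := by
    intro x K
    refine ContDiffOn.sum fun y _ => ?_
    split_ifs
    · exact hsmooth y
    · exact contDiffOn_const
  have hmsymm : ∀ θ x y K, (∀ i ∉ K, y i = x i) → m θ x K = m θ y K := by
    intro θ x y K h
    refine Finset.sum_congr rfl fun z _ => ?_
    have : (∀ i ∉ K, z i = x i) ↔ (∀ i ∉ K, z i = y i) :=
      forall₂_congr fun i hi => by rw [h i hi]
    by_cases h1 : ∀ i ∉ K, z i = x i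
    · rw [if_pos h1, if_pos (this.1 h1)]
    · rw [if_neg h1, if_neg (fun h2 => h1 (this.2 h2))]
  have hK : ∀ θ K, ∑ x, m θs x K * (p θ x / m θ x K) = 1 := by
    intro θ K
    calc ∑ x, m θs x K * (p θ x / m θ x K)
        = ∑ x, ∑ y, (if ∀ i ∉ K, y i = x i then p θs y else 0) * (p θ x / m θ x K) := by
          simp only [hm, Finset.sum_mul]
      _ = ∑ y, ∑ x, (if ∀ i ∉ K, y i = x i then p θs y else 0) * (p θ x / m θ x K) :=
          Finset.sum_comm
      _ = ∑ y, ∑ x, p θs y / m θ y K * (if ∀ i ∉ K, x i = y i then p θ x else 0) := by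
          refine Finset.sum_congr rfl fun y _ => Finset.sum_congr rfl fun x _ => ?_
          by_cases h : ∀ i ∉ K, y i = x i
          · rw [if_pos h, if_pos (fun i hi => (h i hi).symm), hmsymm θ x y K h]
            ring
          · rw [if_neg h, if_neg (fun h2 => h (fun i hi => (h2 i hi).symm))]
            ring
      _ = ∑ y, p θs y := by
          refine Finset.sum_congr rfl fun y _ => ?_
          rw [← Finset.mul_sum]
          exact div_mul_cancel₀ _ (hmpos θ y K).ne'
      _ = 1 := hsum θs
  obtain ⟨h0, h2⟩ := aux_info Θ hΘ θs hθs
    (fun a : (Fin N → Ω) × Finset (Fin N) => pK a.2 * m θs a.1 a.2)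
    (fun a θ => condProb (p θ) a.1 a.2)
    (fun a θ => div_pos (hpos θ a.1) (hmpos θ a.1 a.2))
    (fun a => (hsmooth a.1).div (hmsm a.1 a.2) fun θ _ => (hmpos θ a.1 a.2).ne')
    (by
      intro θ
      rw [Fintype.sum_prod_type_right, ← hpK1]
      refine Finset.sum_congr rfl fun K _ => ?_
      simp only [hcm, mul_assoc]
      rw [← Finset.mul_sum, hK, mul_one])
  have hw : ∀ x K, pK K * m θs x K * condProb (p θs) x K = pX x * pK K := by
    intro x K
    have := (hmpos θs x K).ne'
    rw [hcm, ← hreal]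
    field_simp
  simp only [Fintype.sum_prod_type, hw, ← hscore] at h0 h2
  have hLf : L = fun θ => ∑ x, ∑ K : Finset (Fin N),
      pX x * pK K * (-(Real.log (condProb (p θ) x K))) := funext hL
  have hH : hessAt L θs = Matrix.of (fun i j =>
      ∑ x, ∑ K : Finset (Fin N), pX x * pK K * (score x K i * score x K j)) := by
    ext i j
    rw [hLf]
    exact h2 i j
  refine ⟨?_, hH⟩
  rw [hH]
  ext i j
  simp only [Matrix.of_apply, neg_mul_neg, mul_neg, Finset.sum_neg_distrib, h0]
  simp
end
end

section
/- Generalized information matrix equality (adaptive masking): Under the smoothness and realizability assumptions, ∇²_θ L_PL(θ*) = Cov_{(X,K)∼p_{X,K}}( −∇_θ log p_θ(X_K | X_{−K}, K) )|_{θ=θ*} = E_{(X,K)∼p_{X,K}}[ ∇_θ log p_θ(X_K|X_{−K},K) · ∇_θ log p_θ(X_K|X_{−K},K)ᵀ ]|_{θ=θ*}. -/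
open scoped Classical BigOperators

noncomputable section

/-- The adaptive (mask-conditioned) model conditional
`p_θ(x_K | x_{-K}, K) = p_θ(x) p_K(K|x) / Σ_{y : y_{-K} = x_{-K}} p_θ(y) p_K(K|y)`. -/
def condProbAdaptive {Ω : Type*} [Fintype Ω] {N : ℕ} (q : (Fin N → Ω) → ℝ)
    (r : (Fin N → Ω) → Finset (Fin N) → ℝ)
    (x : Fin N → Ω) (K : Finset (Fin N)) : ℝ :=
  q x * r x K / ∑ y : Fin N → Ω, (if ∀ i ∉ K, y i = x i then q y * r y K else 0)

lemma aux_pderiv_diff {d : ℕ} (j : Fin d) (f : (Fin d → ℝ) → ℝ) (θs : Fin d → ℝ)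
    (hf : ContDiffAt ℝ 2 f θs) : DifferentiableAt ℝ (fun θ => pderivAt j f θ) θs := by
  have h1 : ContDiffAt ℝ 1 (fderiv ℝ f) θs := hf.fderiv_right (by norm_num)
  have h2 : DifferentiableAt ℝ (fderiv ℝ f) θs := h1.differentiableAt (by norm_num)
  unfold pderivAt
  exact h2.clm_apply (differentiableAt_const _)

lemma aux_ev_diff {d : ℕ} (f : (Fin d → ℝ) → ℝ) (θs : Fin d → ℝ)
    (hf : ContDiffAt ℝ 2 f θs) : ∀ᶠ θ in nhds θs, DifferentiableAt ℝ f θ := by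
  filter_upwards [hf.eventually (by simp)] with θ h
  exact h.differentiableAt (by norm_num)

lemma aux_main {ι : Type*} [Fintype ι] {d : ℕ} (a : ι → ℝ) (l : ι → (Fin d → ℝ) → ℝ)
    (θs : Fin d → ℝ) (hl : ∀ k, ContDiffAt ℝ 2 (l k) θs) (c : ℝ)
    (hc : ∀ θ, ∑ k, a k * Real.exp (l k θ) = c) :
    (∀ i, ∑ k, a k * Real.exp (l k θs) * pderivAt i (l k) θs = 0) ∧
    ∀ w : ι → ℝ, (∀ k, w k = a k * Real.exp (l k θs)) →
      ∀ i j, hessAt (fun θ => ∑ k, w k * (-(l k θ))) θs i j =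
        ∑ k, w k * (pderivAt i (l k) θs * pderivAt j (l k) θs) := by
  have hev : ∀ᶠ θ in nhds θs, ∀ k, DifferentiableAt ℝ (l k) θ :=
    Filter.eventually_all.2 fun k => aux_ev_diff _ _ (hl k)
  have h1 : ∀ j, ∀ θ, (∀ k, DifferentiableAt ℝ (l k) θ) →
      ∑ k, a k * (Real.exp (l k θ) * pderivAt j (l k) θ) = 0 := by
    intro j θ hθ
    have hd : HasFDerivAt (fun θ => ∑ k, a k * Real.exp (l k θ))
        (∑ k, a k • (Real.exp (l k θ) • fderiv ℝ (l k) θ)) θ :=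
      HasFDerivAt.fun_sum fun k _ => ((hθ k).hasFDerivAt.exp).const_mul (a k)
    have h0 : HasFDerivAt (fun θ => ∑ k, a k * Real.exp (l k θ))
        (0 : (Fin d → ℝ) →L[ℝ] ℝ) θ := by
      have : (fun θ => ∑ k, a k * Real.exp (l k θ)) = fun _ => c := funext hc
      rw [this]; exact hasFDerivAt_const _ _
    have := congrArg (fun T : (Fin d → ℝ) →L[ℝ] ℝ => T (Pi.single j 1)) (hd.unique h0)
    simpa [pderivAt] using this
  have hdθ : ∀ k, DifferentiableAt ℝ (l k) θs := hev.self_of_nhds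
  refine ⟨fun i => by simpa [mul_assoc] using h1 i θs hdθ, ?_⟩
  intro w hw i j
  have hP : ∀ k, HasFDerivAt (fun θ => pderivAt j (l k) θ)
      (fderiv ℝ (fun θ => pderivAt j (l k) θ) θs) θs :=
    fun k => (aux_pderiv_diff j _ _ (hl k)).hasFDerivAt
  have h2 : ∑ k, a k * (Real.exp (l k θs) * pderivAt i (fun θ => pderivAt j (l k) θ) θs
      + pderivAt j (l k) θs * (Real.exp (l k θs) * pderivAt i (l k) θs)) = 0 := by
    have hd := HasFDerivAt.fun_sum (u := Finset.univ) fun k _ =>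
      (((hdθ k).hasFDerivAt.exp).mul (hP k)).const_mul (a k)
    have h0 : HasFDerivAt (fun θ => ∑ k, a k * (Real.exp (l k θ) * pderivAt j (l k) θ))
        (0 : (Fin d → ℝ) →L[ℝ] ℝ) θs := by
      refine (hasFDerivAt_const (0:ℝ) θs).congr_of_eventuallyEq ?_
      filter_upwards [hev] with θ hθ
      exact h1 j θ hθ
    have := congrArg (fun T : (Fin d → ℝ) →L[ℝ] ℝ => T (Pi.single i 1)) (hd.unique h0)
    simpa [pderivAt, mul_add] using this
  have h3 : hessAt (fun θ => ∑ k, w k * (-(l k θ))) θs i j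
      = ∑ k, w k * (-(pderivAt i (fun θ => pderivAt j (l k) θ) θs)) := by
    have e : (fun θ => pderivAt j (fun θ => ∑ k, w k * (-(l k θ))) θ) =ᶠ[nhds θs]
        fun θ => ∑ k, w k * (-(pderivAt j (l k) θ)) := by
      filter_upwards [hev] with θ hθ
      have := (HasFDerivAt.fun_sum (u := Finset.univ) fun k _ =>
        ((hθ k).hasFDerivAt.fun_neg).const_mul (w k)).fderiv
      simp only [pderivAt]
      rw [this]
      simp
    have hd := (HasFDerivAt.fun_sum (u := Finset.univ) fun k _ =>
        ((hP k).fun_neg).const_mul (w k))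
    have := (hd.congr_of_eventuallyEq e).fderiv
    simp only [hessAt, Matrix.of_apply]
    conv_lhs => rw [pderivAt]
    rw [this]
    simp [pderivAt]
  rw [h3, ← sub_eq_zero, ← Finset.sum_sub_distrib, ← neg_eq_zero, ← Finset.sum_neg_distrib, ← h2]
  refine Finset.sum_congr rfl fun k _ => ?_
  rw [hw]; ring

/-- **Generalized information matrix equality (adaptive masking).**
Under smoothness and realizability, the Hessian of the adaptively weighted pseudolikelihood
loss at the true parameter `θ*` equals the covariance matrix of the negative score of the
mask-conditioned conditional, which in turn equals the second moment matrix of the score. -/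
theorem generalized_information_matrix_equality_adaptive
    {Ω : Type*} [Fintype Ω] {N d : ℕ}
    -- the data distribution pX on Ω^N
    (pX : (Fin N → Ω) → ℝ) (hpX0 : ∀ x, 0 ≤ pX x) (hpX1 : ∑ x, pX x = 1)
    -- the adaptive mask distribution pK(·|x) on subsets of [N]
    (pK : (Fin N → Ω) → Finset (Fin N) → ℝ) (hpK0 : ∀ x K, 0 ≤ pK x K)
    (hpK1 : ∀ x, ∑ K : Finset (Fin N), pK x K = 1)
    -- an open parameter set Θ ⊆ ℝ^d
    (Θ : Set (Fin d → ℝ)) (hΘ : IsOpen Θ)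
    -- a parametric family of strictly positive distributions, C² in θ
    (p : (Fin d → ℝ) → (Fin N → Ω) → ℝ)
    (hpos : ∀ θ x, 0 < p θ x) (hsum : ∀ θ, ∑ x, p θ x = 1)
    (hsmooth : ∀ x, ContDiffOn ℝ 2 (fun θ => p θ x) Θ)
    -- realizability: p_{θ*} = pX at some θ* ∈ Θ
    (θs : Fin d → ℝ) (hθs : θs ∈ Θ) (hreal : p θs = pX)
    -- the adaptively weighted pseudolikelihood loss
    (L : (Fin d → ℝ) → ℝ)
    (hL : ∀ θ, L θ = ∑ x, ∑ K : Finset (Fin N),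
      pX x * pK x K * (-(Real.log (condProbAdaptive (p θ) pK x K))))
    -- the score ∇_θ log p_θ(x_K | x_{-K}, K) evaluated at θ*
    (score : (Fin N → Ω) → Finset (Fin N) → Fin d → ℝ)
    (hscore : ∀ x K i, score x K i
      = pderivAt i (fun θ => Real.log (condProbAdaptive (p θ) pK x K)) θs) :
    -- ∇²L(θ*) = Cov_{(X,K)∼p_{X,K}}(-∇ log p_θ(X_K|X_{-K},K))|_{θ*}
    hessAt L θs
      = Matrix.of (fun i j =>
          (∑ x, ∑ K : Finset (Fin N),
              pX x * pK x K * ((-(score x K i)) * (-(score x K j))))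
          - (∑ x, ∑ K : Finset (Fin N), pX x * pK x K * (-(score x K i)))
            * (∑ x, ∑ K : Finset (Fin N), pX x * pK x K * (-(score x K j))))
    ∧
    -- and it equals E[∇ log p_θ(X_K|X_{-K},K) ∇ log p_θ(X_K|X_{-K},K)ᵀ]|_{θ*}
    hessAt L θs
      = Matrix.of (fun i j =>
          ∑ x, ∑ K : Finset (Fin N), pX x * pK x K * (score x K i * score x K j)) := by
  classical
  set S : (Fin d → ℝ) → (Fin N → Ω) → Finset (Fin N) → ℝ := fun θ x K =>
    ∑ y : Fin N → Ω, (if ∀ i ∉ K, y i = x i then p θ y * pK y K else 0) with hS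
  have hcond : ∀ θ x K, condProbAdaptive (p θ) pK x K = p θ x * pK x K / S θ x K :=
    fun θ x K => rfl
  have hSpos : ∀ θ x K, pK x K ≠ 0 → 0 < S θ x K := by
    intro θ x K h
    refine Finset.sum_pos' (fun y _ => ?_) ⟨x, Finset.mem_univ _, ?_⟩
    · split_ifs
      · exact mul_nonneg (hpos θ y).le (hpK0 y K)
      · exact le_rfl
    · simpa using mul_pos (hpos θ x) (lt_of_le_of_ne (hpK0 x K) (Ne.symm h))
  have hcpos : ∀ θ x K, pK x K ≠ 0 → 0 < condProbAdaptive (p θ) pK x K := by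
    intro θ x K h
    rw [hcond]
    exact div_pos (mul_pos (hpos θ x) (lt_of_le_of_ne (hpK0 x K) (Ne.symm h))) (hSpos θ x K h)
  have hpc : ∀ x, ContDiffAt ℝ 2 (fun θ => p θ x) θs :=
    fun x => (hsmooth x).contDiffAt (hΘ.mem_nhds hθs)
  have hl : ∀ k : (Fin N → Ω) × Finset (Fin N),
      ContDiffAt ℝ 2 (fun θ => Real.log (condProbAdaptive (p θ) pK k.1 k.2)) θs := by
    rintro ⟨x, K⟩
    by_cases h : pK x K = 0
    · simp only [hcond, h, mul_zero, zero_div, Real.log_zero]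
      exact contDiffAt_const
    · refine ContDiffAt.log ?_ (hcpos θs x K h).ne'
      simp only [hcond]
      refine ((hpc x).mul contDiffAt_const).div ?_ (hSpos θs x K h).ne'
      refine ContDiffAt.sum fun y _ => ?_
      split_ifs
      · exact (hpc y).mul contDiffAt_const
      · exact contDiffAt_const
  have hae : ∀ θ x K, (if pK x K = 0 then 0 else S θs x K) *
      Real.exp (Real.log (condProbAdaptive (p θ) pK x K))
      = S θs x K * (p θ x * pK x K / S θ x K) := by
    intro θ x K
    by_cases h : pK x K = 0
    · simp [h]
    · rw [if_neg h, Real.exp_log (hcpos θ x K h), hcond]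
  have hw : ∀ k : (Fin N → Ω) × Finset (Fin N), pX k.1 * pK k.1 k.2 =
      (if pK k.1 k.2 = 0 then 0 else S θs k.1 k.2) *
      Real.exp (Real.log (condProbAdaptive (p θs) pK k.1 k.2)) := by
    rintro ⟨x, K⟩
    rw [hae]
    by_cases h : pK x K = 0
    · simp [h]
    · have := (hSpos θs x K h).ne'
      simp only [← hreal]
      field_simp
  have hSsymm : ∀ θ x y K, (∀ i ∉ K, y i = x i) → S θ x K = S θ y K := by
    intro θ x y K h
    simp only [hS]
    refine Finset.sum_congr rfl fun z _ => ?_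
    congr 1
    exact propext ⟨fun hz i hi => (hz i hi).trans (h i hi).symm,
      fun hz i hi => (hz i hi).trans (h i hi)⟩
  have hconst : ∀ θ, ∑ k : (Fin N → Ω) × Finset (Fin N),
      (if pK k.1 k.2 = 0 then 0 else S θs k.1 k.2) *
      Real.exp (Real.log (condProbAdaptive (p θ) pK k.1 k.2))
      = ∑ K : Finset (Fin N), ∑ y, p θs y * pK y K := by
    intro θ
    rw [Fintype.sum_prod_type_right]
    refine Finset.sum_congr rfl fun K _ => ?_
    simp only [hae]
    calc ∑ x, S θs x K * (p θ x * pK x K / S θ x K)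
        = ∑ x, ∑ y, (if ∀ i ∉ K, y i = x i then p θs y * pK y K else 0) *
            (p θ x * pK x K / S θ x K) := by
          refine Finset.sum_congr rfl fun x _ => ?_
          rw [← Finset.sum_mul]
      _ = ∑ y, ∑ x, (if ∀ i ∉ K, y i = x i then p θs y * pK y K else 0) *
            (p θ x * pK x K / S θ x K) := Finset.sum_comm
      _ = ∑ y, p θs y * pK y K * (S θ y K / S θ y K) := by
          refine Finset.sum_congr rfl fun y _ => ?_
          have : S θ y K / S θ y K = ∑ x : Fin N → Ω,
            (if ∀ i ∉ K, x i = y i then p θ x * pK x K else 0) / S θ y K := by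
            rw [← Finset.sum_div]
          rw [this, Finset.mul_sum]
          refine Finset.sum_congr rfl fun x _ => ?_
          by_cases h : ∀ i ∉ K, y i = x i
          · rw [if_pos h, if_pos (fun i hi => (h i hi).symm), hSsymm θ x y K h]
          · rw [if_neg h, if_neg (fun h' => h fun i hi => (h' i hi).symm)]
            simp
      _ = _ := by
          refine Finset.sum_congr rfl fun y _ => ?_
          by_cases h : pK y K = 0
          · simp [h]
          · rw [div_self (hSpos θ y K h).ne', mul_one]
  obtain ⟨hA, hB⟩ := aux_main _ _ θs hl _ hconst
  have hB := hB (fun k => pX k.1 * pK k.1 k.2) hw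
  have hLe : L = fun θ => ∑ k : (Fin N → Ω) × Finset (Fin N), pX k.1 * pK k.1 k.2 *
      (-(Real.log (condProbAdaptive (p θ) pK k.1 k.2))) := by
    funext θ
    rw [hL, Fintype.sum_prod_type]
  have hH : hessAt L θs = Matrix.of (fun i j =>
      ∑ x, ∑ K : Finset (Fin N), pX x * pK x K * (score x K i * score x K j)) := by
    ext i j
    rw [hLe, hB i j, Fintype.sum_prod_type]
    simp only [Matrix.of_apply, hscore]
  have hZ : ∀ i, ∑ x, ∑ K : Finset (Fin N), pX x * pK x K * (-(score x K i)) = 0 := by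
    intro i
    have := hA i
    simp only [← hw] at this
    rw [Fintype.sum_prod_type] at this
    simp only [mul_neg, Finset.sum_neg_distrib, neg_eq_zero, hscore]
    exact this
  refine ⟨?_, hH⟩
  rw [hH]
  ext i j
  simp only [Matrix.of_apply, hZ, neg_mul_neg, mul_zero, sub_zero]
end
end

section
/- Masking more is statistically better: For every 1 ≤ k < N, the Hessians of the k-masked and (k+1)-masked pseudolikelihood losses at the true parameter satisfy the Loewner ordering ∇²_θ L_PL^{k+1}(θ*) ⪰ ∇²_θ L_PL^{k}(θ*) (their difference is positive semidefinite). Consequently, if ∇²_θ L_PL^{k}(θ*) is positive definite, then the asymptotic covariance matrices satisfy Γ_PL^{k+1} := (∇²_θ L_PL^{k+1}(θ*))^{−1} ⪯ (∇²_θ L_PL^{k}(θ*))^{−1} =: Γ_PL^{k}. -/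
open scoped Classical BigOperators

noncomputable section

def Zc {Ω : Type*} [Fintype Ω] {N : ℕ} (q : (Fin N → Ω) → ℝ)
    (x : Fin N → Ω) (K : Finset (Fin N)) : ℝ :=
  ∑ y : Fin N → Ω, (if ∀ i ∉ K, y i = x i then q y else 0)

lemma Zc_pos {Ω : Type*} [Fintype Ω] {N : ℕ} (q : (Fin N → Ω) → ℝ) (hq : ∀ x, 0 < q x)
    (x : Fin N → Ω) (K : Finset (Fin N)) : 0 < Zc q x K := by
  unfold Zc
  apply Finset.sum_pos'
  · intro y _
    split_ifs
    · exact (hq y).le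
    · exact le_rfl
  · exact ⟨x, Finset.mem_univ _, by simp [hq x]⟩

lemma Zc_inv {Ω : Type*} [Fintype Ω] {N : ℕ} (q : (Fin N → Ω) → ℝ)
    {x y : Fin N → Ω} {K K' : Finset (Fin N)} (hK : K ⊆ K') (h : ∀ i ∉ K, y i = x i) :
    Zc q y K' = Zc q x K' := by
  unfold Zc
  apply Finset.sum_congr rfl
  intro z _
  have : (∀ i ∉ K', z i = y i) ↔ (∀ i ∉ K', z i = x i) := by
    constructor
    · intro hz i hi
      rw [hz i hi, h i (fun hh => hi (hK hh))]
    · intro hz i hi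
      rw [hz i hi, h i (fun hh => hi (hK hh))]
  simp only [this]

lemma Zc_swap {Ω : Type*} [Fintype Ω] {N : ℕ} (a b g : (Fin N → Ω) → ℝ)
    (K : Finset (Fin N)) (hg : ∀ x y : Fin N → Ω, (∀ i ∉ K, y i = x i) → g y = g x) :
    ∑ x, a x * Zc b x K * g x = ∑ x, b x * Zc a x K * g x := by
  unfold Zc
  simp only [Finset.mul_sum, Finset.sum_mul]
  rw [Finset.sum_comm]
  apply Finset.sum_congr rfl
  intro y _
  apply Finset.sum_congr rfl
  intro x _
  by_cases h : ∀ i ∉ K, y i = x i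
  · have h' : ∀ i ∉ K, x i = y i := fun i hi => (h i hi).symm
    rw [if_pos h, if_pos h', hg x y h]
    ring
  · have h' : ¬ ∀ i ∉ K, x i = y i := fun hh => h fun i hi => (hh i hi).symm
    rw [if_neg h, if_neg h']
    ring

lemma gibbs {Ω : Type*} [Fintype Ω] {N : ℕ} (a b : (Fin N → Ω) → ℝ)
    (ha : ∀ x, 0 < a x) (hb : ∀ x, 0 < b x) {K K' : Finset (Fin N)} (hK : K ⊆ K') :
    ∑ x, a x * (Real.log (Zc b x K) - Real.log (Zc a x K))
      ≤ ∑ x, a x * (Real.log (Zc b x K') - Real.log (Zc a x K')) := by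
  have e1 : ∑ x, a x * Zc b x K * (Zc a x K' / (Zc a x K * Zc b x K')) = ∑ x, a x := by
    rw [Zc_swap a b _ K]
    · have : ∀ x, b x * Zc a x K * (Zc a x K' / (Zc a x K * Zc b x K'))
          = b x * Zc a x K' * (Zc b x K')⁻¹ := by
        intro x
        have := (Zc_pos a ha x K).ne'
        have := (Zc_pos b hb x K').ne'
        field_simp
      simp only [this]
      rw [Zc_swap b a _ K']
      · apply Finset.sum_congr rfl
        intro x _
        have := (Zc_pos b hb x K').ne'
        field_simp
      · intro x y h
        rw [Zc_inv b (Finset.Subset.refl _) h]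
    · intro x y h
      rw [Zc_inv a hK h, Zc_inv b hK h, Zc_inv a (Finset.Subset.refl _) h]
  have e2 : ∑ x, a x * (Real.log (Zc b x K) - Real.log (Zc a x K)
      - (Real.log (Zc b x K') - Real.log (Zc a x K')))
      ≤ ∑ x, (a x * Zc b x K * (Zc a x K' / (Zc a x K * Zc b x K')) - a x) := by
    apply Finset.sum_le_sum
    intro x _
    have h1 := Zc_pos a ha x K
    have h2 := Zc_pos b hb x K'
    have h3 := Zc_pos a ha x K'
    have h4 := Zc_pos b hb x K
    have h5 := Real.log_le_sub_one_of_pos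
      (show 0 < Zc b x K * Zc a x K' / (Zc a x K * Zc b x K') by positivity)
    rw [Real.log_div (by positivity) (by positivity), Real.log_mul h4.ne' h3.ne',
      Real.log_mul h1.ne' h2.ne'] at h5
    have h6 := mul_le_mul_of_nonneg_left h5 (ha x).le
    have h7 : a x * Zc b x K * (Zc a x K' / (Zc a x K * Zc b x K')) - a x
      = a x * (Zc b x K * Zc a x K' / (Zc a x K * Zc b x K') - 1) := by ring
    rw [h7]
    refine le_trans (le_of_eq ?_) h6
    ring
  rw [Finset.sum_sub_distrib, e1, sub_self] at e2
  simp only [mul_sub, Finset.sum_sub_distrib] at e2 ⊢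
  linarith

lemma avg_mono {N : ℕ} (f : Finset (Fin N) → ℝ) (hf : ∀ K K', K ⊆ K' → f K ≤ f K')
    (k : ℕ) (hk : k < N) :
    ∑ K ∈ Finset.univ.filter (fun K : Finset (Fin N) => K.card = k),
        ((1 : ℝ) / (N.choose k)) * f K ≤
    ∑ K ∈ Finset.univ.filter (fun K : Finset (Fin N) => K.card = k + 1),
        ((1 : ℝ) / (N.choose (k + 1))) * f K := by
  have h1 : ∑ K ∈ Finset.univ.filter (fun K : Finset (Fin N) => K.card = k),
      ((N : ℝ) - k) * f K =
      ∑ K ∈ Finset.univ.filter (fun K : Finset (Fin N) => K.card = k), ∑ j ∈ Kᶜ, f K := by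
    apply Finset.sum_congr rfl
    intro K hK
    have hK' : K.card = k := by simpa using hK
    rw [Finset.sum_const, Finset.card_compl, hK', Fintype.card_fin, nsmul_eq_mul,
      Nat.cast_sub hk.le]
  have h2 : ∑ K ∈ Finset.univ.filter (fun K : Finset (Fin N) => K.card = k + 1),
      ((k : ℝ) + 1) * f K =
      ∑ K ∈ Finset.univ.filter (fun K : Finset (Fin N) => K.card = k + 1), ∑ j ∈ K, f K := by
    apply Finset.sum_congr rfl
    intro K hK
    have hK' : K.card = k + 1 := by simpa using hK
    rw [Finset.sum_const, hK', nsmul_eq_mul]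
    push_cast
    ring
  have h3 : ∑ K ∈ Finset.univ.filter (fun K : Finset (Fin N) => K.card = k), ∑ j ∈ Kᶜ, f K
      = ∑ K ∈ Finset.univ.filter (fun K : Finset (Fin N) => K.card = k + 1),
          ∑ j ∈ K, f (K.erase j) := by
    rw [Finset.sum_sigma', Finset.sum_sigma']
    refine Finset.sum_bij' (fun a _ => ⟨insert a.2 a.1, a.2⟩) (fun a _ => ⟨a.1.erase a.2, a.2⟩)
      ?_ ?_ ?_ ?_ ?_
    · rintro ⟨K, j⟩ h
      simp at h ⊢
      rw [Finset.card_insert_of_notMem h.2, h.1]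
    · rintro ⟨K, j⟩ h
      simp at h ⊢
      rw [Finset.card_erase_of_mem h.2, h.1]
      rfl
    · rintro ⟨K, j⟩ h
      simp at h ⊢
      exact h.2
    · rintro ⟨K, j⟩ h
      simp at h ⊢
      exact Finset.insert_erase h.2
    · rintro ⟨K, j⟩ h
      simp at h ⊢
      rw [Finset.erase_eq_of_notMem h.2]
  have h4 : ∑ K ∈ Finset.univ.filter (fun K : Finset (Fin N) => K.card = k + 1),
          ∑ j ∈ K, f (K.erase j) ≤
      ∑ K ∈ Finset.univ.filter (fun K : Finset (Fin N) => K.card = k + 1), ∑ j ∈ K, f K :=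
    Finset.sum_le_sum fun K _ => Finset.sum_le_sum fun j _ => hf _ _ (Finset.erase_subset _ _)
  rw [← h3, ← h1, ← h2, ← Finset.mul_sum, ← Finset.mul_sum] at h4
  rw [← Finset.mul_sum, ← Finset.mul_sum]
  have c1 : (0 : ℝ) < N.choose k := by exact_mod_cast Nat.choose_pos hk.le
  have c2 : (0 : ℝ) < N.choose (k + 1) := by exact_mod_cast Nat.choose_pos hk
  have c3 : (N.choose (k + 1) : ℝ) * (k + 1) = N.choose k * ((N : ℝ) - k) := by
    have := Nat.choose_succ_right_eq N k
    rw [← Nat.cast_sub hk.le]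
    exact_mod_cast this
  have c4 : (0 : ℝ) < (k : ℝ) + 1 := by positivity
  generalize (∑ K ∈ Finset.univ.filter (fun K : Finset (Fin N) => K.card = k), f K) = A at *
  generalize (∑ K ∈ Finset.univ.filter (fun K : Finset (Fin N) => K.card = k + 1), f K) = B at *
  rw [one_div_mul_eq_div, one_div_mul_eq_div, div_le_div_iff₀ c1 c2]
  have := mul_le_mul_of_nonneg_left h4 c1.le
  have h6 : (A * N.choose (k + 1)) * ((k : ℝ) + 1) ≤ (B * N.choose k) * ((k : ℝ) + 1) := by
    calc (A * N.choose (k + 1)) * ((k : ℝ) + 1) = A * (N.choose (k + 1) * ((k : ℝ) + 1)) := by ring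
      _ = N.choose k * (((N : ℝ) - k) * A) := by rw [c3]; ring
      _ ≤ _ := this
      _ = _ := by ring
  exact le_of_mul_le_mul_right h6 c4

lemma hess_eq {d : ℕ} (f : (Fin d → ℝ) → ℝ) (θ : Fin d → ℝ) (hf : ContDiffAt ℝ 2 f θ)
    (i j : Fin d) :
    hessAt f θ i j = fderiv ℝ (fderiv ℝ f) θ (Pi.single i 1) (Pi.single j 1) := by
  have h : DifferentiableAt ℝ (fderiv ℝ f) θ :=
    (hf.fderiv_right (m := 1) (by norm_num)).differentiableAt (by norm_num)
  simp only [hessAt, pderivAt, Matrix.of_apply]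
  rw [fderiv_clm_apply h (differentiableAt_const _)]
  simp

lemma hess_sub {d : ℕ} (f g : (Fin d → ℝ) → ℝ) (θ : Fin d → ℝ) (hf : ContDiffAt ℝ 2 f θ)
    (hg : ContDiffAt ℝ 2 g θ) :
    hessAt (fun t => f t - g t) θ = hessAt f θ - hessAt g θ := by
  ext i j
  rw [Matrix.sub_apply, hess_eq _ _ hf, hess_eq _ _ hg, hess_eq _ _ (hf.sub hg)]
  have h : DifferentiableAt ℝ (fderiv ℝ f) θ :=
    (hf.fderiv_right (m := 1) (by norm_num)).differentiableAt (by norm_num)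
  have h' : DifferentiableAt ℝ (fderiv ℝ g) θ :=
    (hg.fderiv_right (m := 1) (by norm_num)).differentiableAt (by norm_num)
  have e : fderiv ℝ (fun t => f t - g t) =ᶠ[nhds θ] fun t => fderiv ℝ f t - fderiv ℝ g t := by
    filter_upwards [hf.eventually (by simp), hg.eventually (by simp)] with t h1 h2
    exact fderiv_fun_sub (h1.differentiableAt (by norm_num)) (h2.differentiableAt (by norm_num))
  rw [e.fderiv_eq, fderiv_fun_sub h h']
  simp

lemma second_nonneg (f : ℝ → ℝ) (hmin : IsLocalMin f 0) (hc : ContinuousAt f 0) :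
    0 ≤ deriv (deriv f) 0 := by
  by_contra hneg
  push Not at hneg
  have hmax := isLocalMax_of_deriv_deriv_neg hneg hmin.deriv_eq_zero hc
  have e : f =ᶠ[nhds 0] fun _ => f 0 := by
    filter_upwards [hmin, hmax] with t h1 h2
    exact le_antisymm h2 h1
  have e2 := e.deriv
  have : deriv (deriv f) 0 = 0 := by
    rw [e2.deriv_eq]
    simp
  linarith

lemma hess_psd {d : ℕ} (f : (Fin d → ℝ) → ℝ) (θ : Fin d → ℝ) (hf : ContDiffAt ℝ 2 f θ)
    (hmin : ∀ t, f θ ≤ f t) : (hessAt f θ).PosSemidef := by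
  have hsym : IsSymmSndFDerivAt ℝ f θ := hf.isSymmSndFDerivAt (by simp)
  have h : DifferentiableAt ℝ (fderiv ℝ f) θ :=
    (hf.fderiv_right (m := 1) (by norm_num)).differentiableAt (by norm_num)
  refine Matrix.PosSemidef.of_dotProduct_mulVec_nonneg ?_ ?_
  · ext i j
    rw [Matrix.conjTranspose_apply, star_trivial, hess_eq _ _ hf, hess_eq _ _ hf]
    exact hsym _ _
  · intro v
    have e1 : star v ⬝ᵥ (hessAt f θ).mulVec v = fderiv ℝ (fderiv ℝ f) θ v v := by
      have hv : v = ∑ i, v i • (Pi.single i 1 : Fin d → ℝ) := pi_eq_sum_univ' v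
      conv_rhs => rw [hv]
      simp only [dotProduct, Matrix.mulVec, hess_eq _ _ hf, map_sum, map_smul,
        ContinuousLinearMap.sum_apply, ContinuousLinearMap.smul_apply, smul_eq_mul,
        Finset.mul_sum, star_trivial]
      rw [Finset.sum_comm]
      refine Finset.sum_congr rfl fun i _ => Finset.sum_congr rfl fun j _ => ?_
      ring
    rw [e1]
    let l : ℝ → (Fin d → ℝ) := fun t => θ + t • v
    have hl0 : l 0 = θ := by simp [l]
    have hl : ∀ t, HasDerivAt l v t := by
      intro t
      have := ((hasDerivAt_id t).smul_const v).const_add θ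
      simpa [l] using this
    have hlc : ContinuousAt l 0 := (hl 0).continuousAt
    have hd : deriv (fun t => f (l t)) =ᶠ[nhds 0] fun t => fderiv ℝ f (l t) v := by
      have : ∀ᶠ y in nhds (l 0), ContDiffAt ℝ 2 f y := by
        rw [hl0]
        exact hf.eventually (by simp)
      filter_upwards [hlc.eventually this] with t ht
      exact ((ht.differentiableAt (by norm_num)).hasFDerivAt.comp_hasDerivAt t (hl t)).deriv
    have hdd : deriv (deriv (fun t => f (l t))) 0 = fderiv ℝ (fderiv ℝ f) θ v v := by
      rw [hd.deriv_eq]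
      have h1 : HasFDerivAt (fderiv ℝ f) (fderiv ℝ (fderiv ℝ f) θ) (l 0) := by
        rw [hl0]; exact h.hasFDerivAt
      have h2 := h1.comp_hasDerivAt (0 : ℝ) (hl 0)
      have h3 := h2.clm_apply (hasDerivAt_const (0 : ℝ) v)
      simpa using h3.deriv
    rw [← hdd]
    apply second_nonneg
    · refine Filter.Eventually.of_forall fun t => ?_
      simp only [hl0]
      exact hmin _
    · have : ContinuousAt f (l 0) := by rw [hl0]; exact hf.continuousAt
      exact ContinuousAt.comp (f := l) this hlc

lemma inv_anti {d : ℕ} (A B : Matrix (Fin d) (Fin d) ℝ) (hA : A.PosDef)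
    (hBA : (B - A).PosSemidef) : (A⁻¹ - B⁻¹).PosSemidef := by
  have hB : B.PosDef := by
    have := hA.add_posSemidef hBA
    simpa using this
  have uA : IsUnit A.det := (Matrix.isUnit_iff_isUnit_det A).1 hA.isUnit
  have uB : IsUnit B.det := (Matrix.isUnit_iff_isUnit_det B).1 hB.isUnit
  have hAi : (A⁻¹).conjTranspose = A⁻¹ := hA.isHermitian.inv
  have hBi : (B⁻¹).conjTranspose = B⁻¹ := hB.isHermitian.inv
  have h1 := hA.posSemidef.conjTranspose_mul_mul_same (A⁻¹ - B⁻¹)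
  have h2 := hBA.conjTranspose_mul_mul_same B⁻¹
  rw [Matrix.conjTranspose_sub, hAi, hBi] at h1
  rw [hBi] at h2
  have h3 := h1.add h2
  convert h3 using 1
  have x1 : A⁻¹ * A = 1 := Matrix.nonsing_inv_mul A uA
  have x2 : A * A⁻¹ = 1 := Matrix.mul_nonsing_inv A uA
  have x3 : B⁻¹ * B = 1 := Matrix.nonsing_inv_mul B uB
  simp only [sub_mul, mul_sub, x1, x3, one_mul, mul_assoc, x2, mul_one]
  abel

/-- **Masking more is (statistically) better.**
For `1 ≤ k < N`, the Hessians of the `k`-masked and `(k+1)`-masked pseudolikelihood losses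
at the true parameter satisfy `∇²L^{k+1}(θ*) ⪰ ∇²L^{k}(θ*)` in the Loewner order, and
consequently (when `∇²L^{k}(θ*)` is positive definite) the asymptotic covariances satisfy
`Γ^{k+1} = (∇²L^{k+1}(θ*))⁻¹ ⪯ (∇²L^{k}(θ*))⁻¹ = Γ^{k}`. -/
theorem masking_more_is_statistically_better
    {Ω : Type*} [Fintype Ω] {N d : ℕ}
    -- the data distribution pX on Ω^N
    (pX : (Fin N → Ω) → ℝ) (hpX0 : ∀ x, 0 ≤ pX x) (hpX1 : ∑ x, pX x = 1)
    -- an open parameter set Θ ⊆ ℝ^d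
    (Θ : Set (Fin d → ℝ)) (hΘ : IsOpen Θ)
    -- a parametric family of strictly positive distributions, C² in θ
    (p : (Fin d → ℝ) → (Fin N → Ω) → ℝ)
    (hpos : ∀ θ x, 0 < p θ x) (hsum : ∀ θ, ∑ x, p θ x = 1)
    (hsmooth : ∀ x, ContDiffOn ℝ 2 (fun θ => p θ x) Θ)
    -- realizability: p_{θ*} = pX at some θ* ∈ Θ
    (θs : Fin d → ℝ) (hθs : θs ∈ Θ) (hreal : p θs = pX)
    -- the k-masked pseudolikelihood loss: K uniform over subsets of size k
    (L : ℕ → (Fin d → ℝ) → ℝ)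
    (hL : ∀ k θ, L k θ =
      ∑ K ∈ Finset.univ.filter (fun K : Finset (Fin N) => K.card = k),
        ((1 : ℝ) / (N.choose k)) *
          ∑ x, pX x * (-(Real.log (condProb (p θ) x K))))
    (k : ℕ) (hk1 : 1 ≤ k) (hkN : k < N) :
    -- ∇²L^{k+1}(θ*) - ∇²L^{k}(θ*) is positive semidefinite
    (hessAt (L (k + 1)) θs - hessAt (L k) θs).PosSemidef
    ∧
    -- and if ∇²L^{k}(θ*) ≻ 0 then (∇²L^{k+1}(θ*))⁻¹ ⪯ (∇²L^{k}(θ*))⁻¹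
    ((hessAt (L k) θs).PosDef →
      ((hessAt (L k) θs)⁻¹ - (hessAt (L (k + 1)) θs)⁻¹).PosSemidef) := by
  have hposX : ∀ x, 0 < pX x := fun x => hreal ▸ hpos θs x
  have hpc : ∀ x, ContDiffAt ℝ 2 (fun θ => p θ x) θs :=
    fun x => (hsmooth x).contDiffAt (hΘ.mem_nhds hθs)
  have hZc : ∀ x K, ContDiffAt ℝ 2 (fun θ => Zc (p θ) x K) θs := by
    intro x K
    unfold Zc
    apply ContDiffAt.sum
    intro y _
    split_ifs
    · exact hpc y
    · exact contDiffAt_const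
  have hLc : ∀ k, ContDiffAt ℝ 2 (L k) θs := by
    intro k
    have e : L k = fun θ => ∑ K ∈ Finset.univ.filter (fun K : Finset (Fin N) => K.card = k),
        ((1 : ℝ) / (N.choose k)) *
          ∑ x, pX x * (-(Real.log (p θ x / Zc (p θ) x K))) := funext (hL k)
    rw [e]
    refine ContDiffAt.sum fun K _ => contDiffAt_const.mul (ContDiffAt.sum fun x _ =>
      contDiffAt_const.mul (ContDiffAt.neg (ContDiffAt.log ((hpc x).div (hZc x K) ?_) ?_)))
    · exact (Zc_pos _ (hpos θs) x K).ne'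
    · exact (div_pos (hpos θs x) (Zc_pos _ (hpos θs) x K)).ne'
  have hLd : ∀ k ≤ N, ∀ θ, L k θ - L k θs =
      ∑ K ∈ Finset.univ.filter (fun K : Finset (Fin N) => K.card = k),
        ((1 : ℝ) / (N.choose k)) *
          ∑ x, pX x * (Real.log (Zc (p θ) x K) - Real.log (Zc pX x K))
      + ∑ x, pX x * (Real.log (pX x) - Real.log (p θ x)) := by
    intro k hk θ
    have c1 : (N.choose k : ℝ) ≠ 0 := by exact_mod_cast (Nat.choose_pos hk).ne'
    have hc : ∑ K ∈ Finset.univ.filter (fun K : Finset (Fin N) => K.card = k),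
        ((1 : ℝ) / (N.choose k)) * (∑ x, pX x * (Real.log (pX x) - Real.log (p θ x)))
        = ∑ x, pX x * (Real.log (pX x) - Real.log (p θ x)) := by
      rw [Finset.sum_const, Finset.univ_filter_card_eq, Finset.card_powersetCard,
        Finset.card_univ, Fintype.card_fin, nsmul_eq_mul]
      field_simp
    rw [← hc, hL, hL, ← Finset.sum_sub_distrib, ← Finset.sum_add_distrib]
    refine Finset.sum_congr rfl fun K _ => ?_
    rw [← mul_sub, ← mul_add, ← Finset.sum_sub_distrib, ← Finset.sum_add_distrib]
    congr 1
    refine Finset.sum_congr rfl fun x _ => ?_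
    have e1 : ∀ θ, Real.log (condProb (p θ) x K) =
        Real.log (p θ x) - Real.log (Zc (p θ) x K) := fun θ =>
      Real.log_div (hpos θ x).ne' (Zc_pos _ (hpos θ) x K).ne'
    rw [e1, e1, hreal]
    ring
  have hmin : ∀ θ, L (k + 1) θs - L k θs ≤ L (k + 1) θ - L k θ := by
    intro θ
    have h1 := hLd k hkN.le θ
    have h2 := hLd (k + 1) hkN θ
    have h3 := avg_mono
      (fun K => ∑ x, pX x * (Real.log (Zc (p θ) x K) - Real.log (Zc pX x K)))
      (fun K K' hK => gibbs pX (p θ) hposX (hpos θ) hK) k hkN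
    linarith
  have hmain : (hessAt (L (k + 1)) θs - hessAt (L k) θs).PosSemidef := by
    rw [← hess_sub _ _ _ (hLc _) (hLc _)]
    exact hess_psd _ _ ((hLc _).sub (hLc _)) hmin
  exact ⟨hmain, fun hA => inv_anti _ _ hA hmain⟩
end
end

section
/- Point-wise generalization bound for learning conditional distributions: Fix θ satisfying the support-margin assumption with constant β. Draw n i.i.d. sequences X^{(1)}, …, X^{(n)} ∼ p_X, and for each i draw m masks i.i.d. from p_K(·|X^{(i)}). Let L̂_PL(θ) = (1/n) Σ_i (1/m) Σ_{j=1}^{m} D_KL( p̃(·|X^{(i)}_{−K_j^{(i)}}, K_j^{(i)}) ‖ p_θ(·|X^{(i)}_{−K_j^{(i)}}, K_j^{(i)}) ) and L̃_PL(θ) = E_{X∼p_X} E_{K∼p_K(·|X)}[ D_KL( p̃(·|X_{−K},K) ‖ p_θ(·|X_{−K},K) ) ]. Then for all ε, t > 0, with probability at least 1 − 2^{N−2}|Ω|^N/(ε² m) − 2 exp( −2 t² / (n (ln(1/β))²) ), it holds that |L̂_PL(θ) − L̃_PL(θ)| < 2^N ε ln(1/β) + t/n. -/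
open scoped Classical BigOperators

noncomputable section

/-- The conditional distribution of a (nonnegative) function `r` on `Ω^N`, conditioned on
agreeing with `x` outside the mask `K`: the distribution on completions `y`. -/
def condAt {Ω : Type*} [Fintype Ω] {N : ℕ} (r : (Fin N → Ω) → ℝ)
    (x : Fin N → Ω) (K : Finset (Fin N)) (y : Fin N → Ω) : ℝ :=
  (if ∀ i ∉ K, y i = x i then r y else 0)
    / ∑ z : Fin N → Ω, (if ∀ i ∉ K, z i = x i then r z else 0)

/-- KL divergence between the conditionals (given mask `K` and context `x_{-K}`)
of two distributions `r` and `q` on `Ω^N`. -/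
def klCond {Ω : Type*} [Fintype Ω] {N : ℕ} (r q : (Fin N → Ω) → ℝ)
    (x : Fin N → Ω) (K : Finset (Fin N)) : ℝ :=
  ∑ y : Fin N → Ω, condAt r x K y * Real.log (condAt r x K y / condAt q x K y)

lemma aux_prod_sum {ι : Type*} [Fintype ι] [DecidableEq ι] {α : Type*} [Fintype α]
    (f : ι → α → ℝ) : ∑ X : ι → α, ∏ i, f i (X i) = ∏ i, ∑ a, f i a := by
  rw [Finset.prod_univ_sum]
  simp

lemma aux_marg {ι : Type*} [Fintype ι] [DecidableEq ι] {α : Type*} [Fintype α]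
    (P : ι → α → ℝ) (hP : ∀ i, ∑ a, P i a = 1) (i0 : ι) (F : α → ℝ) :
    ∑ X : ι → α, (∏ i, P i (X i)) * F (X i0) = ∑ a, P i0 a * F a := by
  have h := aux_prod_sum (fun i a => P i a * (if i = i0 then F a else 1))
  simp only [Finset.prod_mul_distrib, Finset.prod_ite_eq', Finset.mem_univ, if_true] at h
  rw [h, Finset.prod_eq_single i0]
  · simp
  · intro b _ hb
    simp [hb, hP]
  · simp

lemma aux_hoeff_mgf {α : Type*} [Fintype α] (p : α → ℝ) (hp0 : ∀ a, 0 ≤ p a)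
    (hp1 : ∑ a, p a = 1) (h : α → ℝ) (L : ℝ) (hL : 0 ≤ L)
    (hh : ∀ a, 0 ≤ h a ∧ h a ≤ L) (s : ℝ) :
    ∑ a, p a * Real.exp (s * (h a - ∑ b, p b * h b)) ≤ Real.exp (L ^ 2 * s ^ 2 / 8) := by
  letI : MeasurableSpace α := ⊤
  let P : PMF α := PMF.ofFintype (fun a => ENNReal.ofReal (p a)) (by
    rw [← ENNReal.ofReal_sum_of_nonneg (fun a _ => hp0 a), hp1]; simp)
  have hint : ∀ f : α → ℝ, ∫ a, f a ∂P.toMeasure = ∑ a, p a * f a := by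
    intro f
    rw [PMF.integral_eq_sum]
    simp [P, hp0]
  have key := (ProbabilityTheory.hasSubgaussianMGF_of_mem_Icc (μ := P.toMeasure) (X := h)
    (a := 0) (b := L) (measurable_from_top.aemeasurable)
    (Filter.Eventually.of_forall hh)).mgf_le s
  rw [ProbabilityTheory.mgf, hint, hint] at key
  refine key.trans (le_of_eq ?_)
  congr 1
  simp only [sub_zero]
  push_cast
  rw [Real.norm_eq_abs, abs_of_nonneg hL]
  ring

lemma aux_chernoff {α : Type*} [Fintype α] (p : α → ℝ) (hp0 : ∀ a, 0 ≤ p a)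
    (d : α → ℝ) (L : ℝ) (hL : 0 < L)
    (hd : ∀ s, ∑ a, p a * Real.exp (s * d a) ≤ Real.exp (L ^ 2 * s ^ 2 / 8))
    (n : ℕ) (hn : 0 < n) (t : ℝ) (ht : 0 < t) :
    ∑ X : Fin n → α, (∏ i, p (X i)) * (if t ≤ ∑ i, d (X i) then 1 else 0)
      ≤ Real.exp (-(2 * t ^ 2) / (n * L ^ 2)) := by
  have hn' : (0:ℝ) < n := by exact_mod_cast hn
  set s : ℝ := 4 * t / (n * L ^ 2) with hs
  have hs0 : 0 < s := by positivity
  calc _ ≤ ∑ X : Fin n → α, (∏ i, p (X i) * Real.exp (s * d (X i))) * Real.exp (-(s * t)) := by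
        apply Finset.sum_le_sum
        intro X _
        rw [Finset.prod_mul_distrib, mul_assoc]
        apply mul_le_mul_of_nonneg_left _ (Finset.prod_nonneg fun i _ => hp0 _)
        rw [← Real.exp_sum, ← Finset.mul_sum, ← Real.exp_add]
        split_ifs with hc
        · apply Real.one_le_exp
          nlinarith
        · positivity
    _ = (∑ a, p a * Real.exp (s * d a)) ^ n * Real.exp (-(s * t)) := by
        rw [← Finset.sum_mul, aux_prod_sum (fun (_ : Fin n) a => p a * Real.exp (s * d a))]
        simp
    _ ≤ (Real.exp (L ^ 2 * s ^ 2 / 8)) ^ n * Real.exp (-(s * t)) := by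
        gcongr
        · exact Finset.sum_nonneg fun a _ => mul_nonneg (hp0 a) (Real.exp_pos _).le
        · exact hd s
    _ = _ := by
        rw [← Real.exp_nat_mul, ← Real.exp_add, hs]
        congr 1
        field_simp
        ring

lemma aux_hoeff {α : Type*} [Fintype α] (p : α → ℝ) (hp0 : ∀ a, 0 ≤ p a)
    (hp1 : ∑ a, p a = 1) (h : α → ℝ) (L : ℝ) (hL : 0 < L)
    (hh : ∀ a, 0 ≤ h a ∧ h a ≤ L) (n : ℕ) (hn : 0 < n) (t : ℝ) (ht : 0 < t) :
    ∑ X : Fin n → α, (∏ i, p (X i)) *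
      (if t ≤ |∑ i, (h (X i) - ∑ b, p b * h b)| then 1 else 0)
      ≤ 2 * Real.exp (-(2 * t ^ 2) / (n * L ^ 2)) := by
  have h1 := aux_chernoff p hp0 (fun a => h a - ∑ b, p b * h b) L hL
    (fun s => aux_hoeff_mgf p hp0 hp1 h L hL.le hh s) n hn t ht
  have h2 := aux_chernoff p hp0 (fun a => -(h a - ∑ b, p b * h b)) L hL
    (fun s => by
      have := aux_hoeff_mgf p hp0 hp1 h L hL.le hh (-s)
      simpa only [neg_mul, mul_neg, neg_sq, even_two.neg_pow] using this) n hn t ht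
  rw [two_mul]
  refine le_trans ?_ (add_le_add h1 h2)
  rw [← Finset.sum_add_distrib]
  apply Finset.sum_le_sum
  intro X _
  rw [← mul_add]
  apply mul_le_mul_of_nonneg_left _ (Finset.prod_nonneg fun i _ => hp0 _)
  rw [Finset.sum_neg_distrib]
  by_cases hc : t ≤ |∑ i, (h (X i) - ∑ b, p b * h b)|
  · rw [if_pos hc]
    rcases le_abs.1 hc with h | h
    · rw [if_pos h]; split_ifs <;> norm_num
    · rw [if_pos h]; split_ifs <;> norm_num
  · rw [if_neg hc]; split_ifs <;> norm_num

lemma aux_var {α : Type*} [Fintype α] (p : α → ℝ) 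
    (hp1 : ∑ a, p a = 1) (d : α → ℝ) (hd : ∑ a, p a * d a = 0) (m : ℕ) :
    ∑ Y : Fin m → α, (∏ j, p (Y j)) * (∑ j, d (Y j)) ^ 2 = m * ∑ a, p a * d a ^ 2 := by
  induction m with
  | zero => simp
  | succ m ih =>
    rw [← (Fin.consEquiv (fun _ => α)).sum_comp, Fintype.sum_prod_type]
    simp only [Fin.consEquiv_apply, Fin.prod_univ_succ, Fin.sum_univ_succ, Fin.cons_zero,
      Fin.cons_succ]
    have h1 : ∑ Y : Fin m → α, ∏ j, p (Y j) = 1 := by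
      rw [aux_prod_sum (fun (_ : Fin m) a => p a)]; simp [hp1]
    have : ∀ a, ∑ Y : Fin m → α, p a * (∏ j, p (Y j)) * (d a + ∑ j, d (Y j)) ^ 2
        = p a * d a ^ 2 + p a * d a * (2 * ∑ Y : Fin m → α, (∏ j, p (Y j)) * ∑ j, d (Y j))
          + p a * (m * ∑ a, p a * d a ^ 2) := by
      intro a
      rw [← ih]
      have e : p a * d a ^ 2 = p a * d a ^ 2 * ∑ Y : Fin m → α, ∏ j, p (Y j) := by rw [h1, mul_one]
      rw [e]
      simp only [Finset.mul_sum (Finset.univ : Finset (Fin m → α))]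
      rw [← Finset.sum_add_distrib, ← Finset.sum_add_distrib]
      exact Finset.sum_congr rfl fun Y _ => by ring
    simp only [this]
    rw [Finset.sum_add_distrib, Finset.sum_add_distrib, ← Finset.sum_mul, ← Finset.sum_mul, hd, hp1]
    push_cast
    ring

lemma aux_popo {α : Type*} [Fintype α] (p : α → ℝ) (hp0 : ∀ a, 0 ≤ p a)
    (hp1 : ∑ a, p a = 1) (h : α → ℝ) (L : ℝ)
    (hh : ∀ a, 0 ≤ h a ∧ h a ≤ L) :
    ∑ a, p a * (h a - ∑ b, p b * h b) ^ 2 ≤ L ^ 2 / 4 := by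
  set g := ∑ b, p b * h b with hg
  calc _ ≤ ∑ a, (p a * h a * (L - 2 * g) + p a * g ^ 2) := by
        apply Finset.sum_le_sum
        intro a _
        have := mul_nonneg (hp0 a) (mul_nonneg (hh a).1 (sub_nonneg.2 (hh a).2))
        nlinarith
    _ = g * (L - 2 * g) + g ^ 2 := by
        rw [Finset.sum_add_distrib, ← Finset.sum_mul, ← Finset.sum_mul, hp1, ← hg, one_mul]
    _ ≤ _ := by nlinarith [sq_nonneg (L - 2 * g)]

lemma aux_mean {α : Type*} [Fintype α] (p : α → ℝ) (hp0 : ∀ a, 0 ≤ p a)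
    (hp1 : ∑ a, p a = 1) (h : α → ℝ) (L : ℝ)
    (hh : ∀ a, 0 ≤ h a ∧ h a ≤ L) : 0 ≤ ∑ a, p a * h a ∧ ∑ a, p a * h a ≤ L := by
  constructor
  · exact Finset.sum_nonneg fun a _ => mul_nonneg (hp0 a) (hh a).1
  · calc _ ≤ ∑ a, p a * L := Finset.sum_le_sum fun a _ => mul_le_mul_of_nonneg_left (hh a).2 (hp0 a)
      _ = L := by rw [← Finset.sum_mul, hp1, one_mul]

/-- Conditional Chebyshev step. -/
lemma aux_cheb {α : Type*} [Fintype α] {n m : ℕ} (hn : 0 < n) (hm : 0 < m)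
    (p : Fin n → α → ℝ) (hp0 : ∀ i a, 0 ≤ p i a) (hp1 : ∀ i, ∑ a, p i a = 1)
    (h : Fin n → α → ℝ) (L : ℝ) (hh : ∀ i a, 0 ≤ h i a ∧ h i a ≤ L) (c : ℝ) (hc : 0 < c) :
    ∑ M : Fin n → Fin m → α, (∏ i, ∏ j, p i (M i j)) *
      (if c ≤ |(1 : ℝ) / n * ∑ i, ((1 : ℝ) / m * ∑ j, h i (M i j) - ∑ a, p i a * h i a)|
        then 1 else 0) ≤ L ^ 2 / (4 * m * c ^ 2) := by
  have hn' : (0:ℝ) < n := by exact_mod_cast hn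
  have hm' : (0:ℝ) < m := by exact_mod_cast hm
  set g : Fin n → ℝ := fun i => ∑ a, p i a * h i a with hg
  have hP0 : ∀ M : Fin n → Fin m → α, 0 ≤ ∏ i, ∏ j, p i (M i j) := fun M =>
    Finset.prod_nonneg fun i _ => Finset.prod_nonneg fun j _ => hp0 _ _
  have hP1 : ∀ i, ∑ Y : Fin m → α, ∏ j, p i (Y j) = 1 := fun i => by
    rw [aux_prod_sum (fun (_ : Fin m) a => p i a)]; simp [hp1]
  have hvar : ∀ i, ∑ Y : Fin m → α, (∏ j, p i (Y j)) * (∑ j, (h i (Y j) - g i)) ^ 2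
      ≤ m * (L ^ 2 / 4) := by
    intro i
    rw [aux_var (p i) (hp1 i) (fun a => h i a - g i) (by
      simp only [mul_sub, Finset.sum_sub_distrib]
      rw [← Finset.sum_mul, hp1, one_mul, sub_self])]
    exact mul_le_mul_of_nonneg_left (aux_popo _ (hp0 i) (hp1 i) _ _ (hh i)) hm'.le
  calc _ ≤ ∑ M : Fin n → Fin m → α, (∏ i, ∏ j, p i (M i j)) *
        ∑ i, (∑ j, (h i (M i j) - g i)) ^ 2 * (1 / (n * m ^ 2 * c ^ 2)) := by
        apply Finset.sum_le_sum
        intro M _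
        apply mul_le_mul_of_nonneg_left _ (hP0 M)
        split_ifs with hcc
        · rw [← Finset.sum_mul, mul_one_div, le_div_iff₀ (by positivity), one_mul]
          have e : (1 : ℝ) / n * ∑ i, ((1 : ℝ) / m * ∑ j, h i (M i j) - ∑ a, p i a * h i a)
              = (∑ i, ∑ j, (h i (M i j) - g i)) / (n * m) := by
            rw [eq_div_iff (by positivity)]
            have : ∀ i, ∑ j, (h i (M i j) - g i)
                = m * ((1 : ℝ) / m * ∑ j, h i (M i j) - ∑ a, p i a * h i a) := by
              intro i
              rw [Finset.sum_sub_distrib]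
              simp [hg]
              field_simp
            simp only [this]
            rw [← Finset.mul_sum]
            field_simp
          rw [e, abs_div, abs_of_pos (by positivity : (0:ℝ) < n * m),
            le_div_iff₀ (by positivity)] at hcc
          have h2 : (c * (n * m)) ^ 2 ≤ (∑ i, ∑ j, (h i (M i j) - g i)) ^ 2 := by
            rw [← sq_abs (∑ i, ∑ j, (h i (M i j) - g i))]
            exact pow_le_pow_left₀ (by positivity) hcc 2
          have h3 := sq_sum_le_card_mul_sum_sq (s := (Finset.univ : Finset (Fin n)))
            (f := fun i => ∑ j, (h i (M i j) - g i))
          simp only [Finset.card_univ, Fintype.card_fin] at h3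
          have h4 := h2.trans h3
          have : (c * (n * m)) ^ 2 = n * (n * m ^ 2 * c ^ 2) := by ring
          rw [this] at h4
          exact le_of_mul_le_mul_left h4 hn'
        · exact Finset.sum_nonneg fun i _ => by positivity
    _ = ∑ i, (∑ Y : Fin m → α, (∏ j, p i (Y j)) * (∑ j, (h i (Y j) - g i)) ^ 2)
          * (1 / (n * m ^ 2 * c ^ 2)) := by
        simp only [Finset.mul_sum (Finset.univ : Finset (Fin n))]
        rw [Finset.sum_comm]
        apply Finset.sum_congr rfl
        intro i _
        rw [aux_marg (fun i (Y : Fin m → α) => ∏ j, p i (Y j)) hP1 i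
          (fun Y => (∑ j, (h i (Y j) - g i)) ^ 2 * (1 / (n * m ^ 2 * c ^ 2))), Finset.sum_mul]
        exact Finset.sum_congr rfl fun Y _ => by ring
    _ ≤ ∑ i : Fin n, (m * (L ^ 2 / 4)) * (1 / (n * m ^ 2 * c ^ 2)) := by
        apply Finset.sum_le_sum
        intro i _
        exact mul_le_mul_of_nonneg_right (hvar i) (by positivity)
    _ = _ := by
        simp
        field_simp

lemma aux_kl {Ω : Type*} [Fintype Ω] {N : ℕ}
    (pt : (Fin N → Ω) → ℝ) (hpt0 : ∀ x, 0 ≤ pt x)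
    (q : (Fin N → Ω) → ℝ) (hq0 : ∀ x, 0 ≤ q x)
    (β : ℝ) (hβ0 : 0 < β) (hβ1 : β ≤ 1)
    (hmargin : ∀ (x : Fin N → Ω) (K : Finset (Fin N)) (y : Fin N → Ω),
      (∀ i ∉ K, y i = x i) → β ≤ condAt q x K y) (x : Fin N → Ω) (K : Finset (Fin N)) :
    0 ≤ klCond pt q x K ∧ klCond pt q x K ≤ Real.log (1 / β) := by
  have hL : 0 ≤ Real.log (1 / β) := Real.log_nonneg (by rw [le_div_iff₀ hβ0]; linarith)
  have hnn : ∀ (r : (Fin N → Ω) → ℝ), (∀ x, 0 ≤ r x) → ∀ y, 0 ≤ condAt r x K y := by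
    intro r hr y
    unfold condAt
    apply div_nonneg
    · split_ifs <;> simp [hr]
    · exact Finset.sum_nonneg fun z _ => by split_ifs <;> simp [hr]
  have hsum : ∀ (r : (Fin N → Ω) → ℝ), 
      (∑ z : Fin N → Ω, (if ∀ i ∉ K, z i = x i then r z else 0)) ≠ 0 →
      ∑ y, condAt r x K y = 1 := by
    intro r hr
    unfold condAt
    rw [← Finset.sum_div, div_self hr]
  have hzero : ∀ (r : (Fin N → Ω) → ℝ) y, ¬ (∀ i ∉ K, y i = x i) → condAt r x K y = 0 := by
    intro r y hy
    unfold condAt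
    rw [if_neg hy, zero_div]
  by_cases hz : (∑ z : Fin N → Ω, (if ∀ i ∉ K, z i = x i then pt z else 0)) = 0
  · have : klCond pt q x K = 0 := by
      unfold klCond
      apply Finset.sum_eq_zero
      intro y _
      have : condAt pt x K y = 0 := by
        unfold condAt
        rw [hz, div_zero]
      rw [this, zero_mul]
    rw [this]
    exact ⟨le_rfl, hL⟩
  have hr1 := hsum pt hz
  have hq1 : ∑ y, condAt q x K y = 1 := by
    apply hsum
    intro h0
    have := hmargin x K x (fun i _ => rfl)
    unfold condAt at this
    rw [h0, div_zero] at this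
    linarith
  have hr0 := hnn pt hpt0
  have hle1 : ∀ y, condAt pt x K y ≤ 1 := fun y => by
    rw [← hr1]
    exact Finset.single_le_sum (fun z _ => hr0 z) (Finset.mem_univ y)
  constructor
  · have : ∑ y, (condAt pt x K y - condAt q x K y) ≤ klCond pt q x K := by
      unfold klCond
      apply Finset.sum_le_sum
      intro y _
      by_cases hy : ∀ i ∉ K, y i = x i
      · have hqp : 0 < condAt q x K y := hβ0.trans_le (hmargin x K y hy)
        rcases (hr0 y).eq_or_lt with h0 | h0
        · rw [← h0]; simp; exact hqp.le
        · have := Real.one_sub_inv_le_log_of_pos (div_pos h0 hqp)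
          have h2 := mul_le_mul_of_nonneg_left this h0.le
          refine le_trans (le_of_eq ?_) h2
          field_simp
      · rw [hzero _ _ hy, hzero _ _ hy]; simp
    rw [Finset.sum_sub_distrib, hr1, hq1, sub_self] at this
    exact this
  · unfold klCond
    calc _ ≤ ∑ y, condAt pt x K y * Real.log (1 / β) := by
          apply Finset.sum_le_sum
          intro y _
          by_cases hy : ∀ i ∉ K, y i = x i
          · have hqb := hmargin x K y hy
            have hqp : 0 < condAt q x K y := hβ0.trans_le hqb
            rcases (hr0 y).eq_or_lt with h0 | h0
            · rw [← h0]; simp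
            · apply mul_le_mul_of_nonneg_left _ h0.le
              apply Real.log_le_log (div_pos h0 hqp)
              exact div_le_div₀ zero_le_one (hle1 y) hβ0 hqb
          · rw [hzero _ _ hy]; simp
      _ = _ := by rw [← Finset.sum_mul, hr1, one_mul]

/-- **Point-wise generalization bound for learning conditional distributions.**
Fix a model distribution `q = p_θ` satisfying the support-margin assumption with constant
`β`.  Draw `n` i.i.d. sequences from `p_X` and, for each, `m` i.i.d. masks from
`p_K(·|X⁽ⁱ⁾)`.  Then for all `ε, t > 0`, with probability at least
`1 - 2^{N-2}|Ω|^N/(ε²m) - 2 exp(-2t²/(n (ln(1/β))²))`, the empirical pseudolikelihood loss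
`L̂_PL(θ)` is within `2^N ε ln(1/β) + t/n` of the population loss `L̃_PL(θ)`. -/
theorem pointwise_generalization_bound
    {Ω : Type*} [Fintype Ω] {N n m : ℕ} (hn : 0 < n) (hm : 0 < m)
    (pX : (Fin N → Ω) → ℝ) (hpX0 : ∀ x, 0 ≤ pX x) (hpX1 : ∑ x, pX x = 1)
    (pK : (Fin N → Ω) → Finset (Fin N) → ℝ) (hpK0 : ∀ x K, 0 ≤ pK x K)
    (hpK1 : ∀ x, ∑ K : Finset (Fin N), pK x K = 1)
    -- the fixed reference distribution p̃ on Ω^N (whose conditionals are the targets)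
    (pt : (Fin N → Ω) → ℝ) (hpt0 : ∀ x, 0 ≤ pt x) (hpt1 : ∑ x, pt x = 1)
    -- the model distribution q = p_θ, with support margin β on its conditionals
    (q : (Fin N → Ω) → ℝ) (hq0 : ∀ x, 0 ≤ q x)
    (β : ℝ) (hβ0 : 0 < β) (hβ1 : β ≤ 1)
    (hmargin : ∀ (x : Fin N → Ω) (K : Finset (Fin N)) (y : Fin N → Ω),
      (∀ i ∉ K, y i = x i) → β ≤ condAt q x K y)
    (ε t : ℝ) (hε : 0 < ε) (ht : 0 < t) :
    1 - (2 : ℝ) ^ N * (Fintype.card Ω : ℝ) ^ N / (4 * ε ^ 2 * m)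
      - 2 * Real.exp (-(2 * t ^ 2) / (n * (Real.log (1 / β)) ^ 2)) ≤
      ∑ X : Fin n → (Fin N → Ω), ∑ M : Fin n → Fin m → Finset (Fin N),
        ((∏ i, pX (X i)) * ∏ i, ∏ j, pK (X i) (M i j)) *
          (if
              -- |L̂_PL(θ) - L̃_PL(θ)| < 2^N ε ln(1/β) + t/n
              |((1 : ℝ) / n) * ∑ i, ((1 : ℝ) / m) * ∑ j, klCond pt q (X i) (M i j)
                  - ∑ x, pX x * ∑ K : Finset (Fin N), pK x K * klCond pt q x K|
                < (2 : ℝ) ^ N * ε * Real.log (1 / β) + t / n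
           then 1 else 0) := by
  set L := Real.log (1 / β) with hLdef
  have hn' : (0:ℝ) < n := by exact_mod_cast hn
  have hm' : (0:ℝ) < m := by exact_mod_cast hm
  have hL : 0 ≤ L := Real.log_nonneg (by rw [le_div_iff₀ hβ0]; linarith)
  have hw0 : ∀ (X : Fin n → (Fin N → Ω)) (M : Fin n → Fin m → Finset (Fin N)),
      0 ≤ (∏ i, pX (X i)) * ∏ i, ∏ j, pK (X i) (M i j) := fun X M =>
    mul_nonneg (Finset.prod_nonneg fun i _ => hpX0 _)
      (Finset.prod_nonneg fun i _ => Finset.prod_nonneg fun j _ => hpK0 _ _)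
  rcases hL.eq_or_lt with hL0 | hLpos
  · rw [← hL0]
    have h1 : (0:ℝ) ≤ (2 : ℝ) ^ N * (Fintype.card Ω : ℝ) ^ N / (4 * ε ^ 2 * m) := by positivity
    refine le_trans (b := 0) ?_ ?_
    · simp; linarith
    · exact Finset.sum_nonneg fun X _ => Finset.sum_nonneg fun M _ =>
        mul_nonneg (hw0 X M) (by split_ifs <;> norm_num)
  have hkl := aux_kl pt hpt0 q hq0 β hβ0 hβ1 hmargin
  rw [← hLdef] at hkl
  set g : (Fin N → Ω) → ℝ := fun x => ∑ K : Finset (Fin N), pK x K * klCond pt q x K with hg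
  have hgb : ∀ x, 0 ≤ g x ∧ g x ≤ L := fun x =>
    aux_mean (pK x) (hpK0 x) (hpK1 x) (klCond pt q x) L (hkl x)
  have hM1 : ∀ X : Fin n → (Fin N → Ω),
      ∑ M : Fin n → Fin m → Finset (Fin N), ∏ i, ∏ j, pK (X i) (M i j) = 1 := by
    intro X
    rw [aux_prod_sum (fun i (Y : Fin m → Finset (Fin N)) => ∏ j, pK (X i) (Y j))]
    apply Finset.prod_eq_one
    intro i _
    rw [aux_prod_sum (fun (_ : Fin m) K => pK (X i) K)]
    simp [hpK1]
  have hX1 : ∑ X : Fin n → (Fin N → Ω), ∏ i, pX (X i) = 1 := by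
    rw [aux_prod_sum (fun (_ : Fin n) x => pX x)]; simp [hpX1]
  set c := (2 : ℝ) ^ N * ε * L with hc
  have hcpos : 0 < c := by positivity
  have hA : ∑ X : Fin n → (Fin N → Ω), ∑ M : Fin n → Fin m → Finset (Fin N),
      ((∏ i, pX (X i)) * ∏ i, ∏ j, pK (X i) (M i j)) *
        (if c ≤ |(1 : ℝ) / n * ∑ i, ((1 : ℝ) / m * ∑ j, klCond pt q (X i) (M i j) - g (X i))|
          then (1:ℝ) else 0) ≤ (2 : ℝ) ^ N * (Fintype.card Ω : ℝ) ^ N / (4 * ε ^ 2 * m) := by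
    calc _ ≤ ∑ X : Fin n → (Fin N → Ω), (∏ i, pX (X i)) * (L ^ 2 / (4 * m * c ^ 2)) := by
          apply Finset.sum_le_sum
          intro X _
          simp only [mul_assoc]
          rw [← Finset.mul_sum]
          apply mul_le_mul_of_nonneg_left _ (Finset.prod_nonneg fun i _ => hpX0 _)
          have := aux_cheb hn hm (fun i => pK (X i)) (fun i => hpK0 _) (fun i => hpK1 _)
            (fun i => klCond pt q (X i)) L (fun i => hkl _) c hcpos
          simpa only [mul_assoc] using this
      _ = 1 / (2 ^ N) ^ 2 / (4 * ε ^ 2 * m) := by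
          rw [← Finset.sum_mul, hX1, hc]
          field_simp
      _ ≤ _ := by
          apply div_le_div_of_nonneg_right _ (by positivity)
          have h2 : (1:ℝ) ≤ 2 ^ N := one_le_pow₀ (by norm_num)
          have h3 : (1:ℝ) ≤ (Fintype.card Ω : ℝ) ^ N := by
            have : Nonempty (Fin N → Ω) := by
              by_contra hne
              rw [not_nonempty_iff] at hne
              simp at hpX1
            have h4 : 1 ≤ Fintype.card (Fin N → Ω) := Fintype.card_pos
            rw [Fintype.card_fun, Fintype.card_fin] at h4
            exact_mod_cast h4
          calc (1:ℝ) / (2 ^ N) ^ 2 ≤ 1 := by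
                rw [div_le_one (by positivity)]; exact one_le_pow₀ h2
            _ ≤ _ := by nlinarith
  have hB : ∑ X : Fin n → (Fin N → Ω), ∑ M : Fin n → Fin m → Finset (Fin N),
      ((∏ i, pX (X i)) * ∏ i, ∏ j, pK (X i) (M i j)) *
        (if t ≤ |∑ i, (g (X i) - ∑ x, pX x * g x)| then (1:ℝ) else 0)
        ≤ 2 * Real.exp (-(2 * t ^ 2) / (n * L ^ 2)) := by
    refine le_trans (le_of_eq ?_) (aux_hoeff pX hpX0 hpX1 g L hLpos hgb n hn t ht)
    apply Finset.sum_congr rfl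
    intro X _
    rw [← Finset.sum_mul, ← Finset.mul_sum, hM1, mul_one]
  have hT : ∑ X : Fin n → (Fin N → Ω), ∑ M : Fin n → Fin m → Finset (Fin N),
      ((∏ i, pX (X i)) * ∏ i, ∏ j, pK (X i) (M i j)) = 1 := by
    simp only [← Finset.mul_sum, hM1, mul_one, hX1]
  have hkey : (1:ℝ) ≤ (∑ X : Fin n → (Fin N → Ω), ∑ M : Fin n → Fin m → Finset (Fin N),
        ((∏ i, pX (X i)) * ∏ i, ∏ j, pK (X i) (M i j)) *
          (if |((1 : ℝ) / n) * ∑ i, ((1 : ℝ) / m) * ∑ j, klCond pt q (X i) (M i j)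
                  - ∑ x, pX x * g x| < c + t / n then (1:ℝ) else 0))
      + (∑ X : Fin n → (Fin N → Ω), ∑ M : Fin n → Fin m → Finset (Fin N),
      ((∏ i, pX (X i)) * ∏ i, ∏ j, pK (X i) (M i j)) *
        (if c ≤ |(1 : ℝ) / n * ∑ i, ((1 : ℝ) / m * ∑ j, klCond pt q (X i) (M i j) - g (X i))|
          then (1:ℝ) else 0))
      + (∑ X : Fin n → (Fin N → Ω), ∑ M : Fin n → Fin m → Finset (Fin N),
      ((∏ i, pX (X i)) * ∏ i, ∏ j, pK (X i) (M i j)) *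
        (if t ≤ |∑ i, (g (X i) - ∑ x, pX x * g x)| then (1:ℝ) else 0)) := by
    simp only [← Finset.sum_add_distrib, ← mul_add]
    nth_rewrite 1 [← hT]
    apply Finset.sum_le_sum
    intro X _
    apply Finset.sum_le_sum
    intro M _
    apply le_mul_of_one_le_right (hw0 X M)
    by_cases h1 : c ≤ |(1 : ℝ) / n *
        ∑ i, ((1 : ℝ) / m * ∑ j, klCond pt q (X i) (M i j) - g (X i))|
    · rw [if_pos h1]; split_ifs <;> norm_num
    by_cases h2 : t ≤ |∑ i, (g (X i) - ∑ x, pX x * g x)|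
    · rw [if_pos h2]; split_ifs <;> norm_num
    rw [if_pos]
    · rw [if_neg h1, if_neg h2]; norm_num
    have e : ((1 : ℝ) / n) * ∑ i, ((1 : ℝ) / m) * ∑ j, klCond pt q (X i) (M i j)
                  - ∑ x, pX x * g x
        = (1 : ℝ) / n * ∑ i, ((1 : ℝ) / m * ∑ j, klCond pt q (X i) (M i j) - g (X i))
          + (∑ i, (g (X i) - ∑ x, pX x * g x)) / n := by
      simp only [Finset.sum_sub_distrib, Finset.sum_const, Finset.card_univ, Fintype.card_fin,
        nsmul_eq_mul]
      field_simp
      ring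
    rw [e]
    refine lt_of_le_of_lt (abs_add_le _ _) (add_lt_add (not_le.1 h1) ?_)
    rw [abs_div, abs_of_pos hn']
    exact div_lt_div_of_pos_right (not_le.1 h2) hn'
  linarith
end
end

section
/- Generalization bound for learning the joint distribution: Under the support-margin assumption (with constant β) for all θ ∈ Θ, the complexity assumption (partition of Θ into C_ε(Θ) pieces within which L̂_PL and L̃_PL each vary by at most ε/2), and assuming the constant C̄_AT(p_{θ̂}) ≥ 0 satisfies the block-generalized approximate tensorization inequality D_KL(π ‖ p_{θ̂}) ≤ C̄_AT(p_{θ̂}) · E_{X∼π} E_{K∼p_K(·|X)}[ D_KL( π(·|X_{−K},K) ‖ p_{θ̂}(·|X_{−K},K) ) ] for π ∈ {p_X, p̃}: for every δ ∈ (0,1), with probability at least 1 − δ over the training data (n i.i.d. sequences, m i.i.d. masks per sequence), the estimated model θ̂ satisfies TV(p_{θ̂}, p_X) < sqrt( (1/2) C̄_AT(p_{θ̂}) ( L̂_PL(θ̂) + ( sqrt( 2^{3N} |Ω|^N C_ε(Θ) / (m δ) ) + sqrt( ln(8 C_ε(Θ)/δ) / (2n) ) ) ln(1/β) + ε ) )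 + sqrt( |Ω|^{3N} / (8 δ n) ). -/
open scoped Classical BigOperators

noncomputable section

/-- KL divergence between two distributions on `Ω^N`. -/
def klFull {Ω : Type*} [Fintype Ω] {N : ℕ} (r q : (Fin N → Ω) → ℝ) : ℝ :=
  ∑ x : Fin N → Ω, r x * Real.log (r x / q x)

/-- Total variation distance between two distributions on `Ω^N`. -/
def tvDist {Ω : Type*} [Fintype Ω] {N : ℕ} (r q : (Fin N → Ω) → ℝ) : ℝ :=
  (1 / 2 : ℝ) * ∑ x : Fin N → Ω, |r x - q x|

/-- The empirical distribution of `n` samples on `Ω^N`. -/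
def empDist {Ω : Type*} [Fintype Ω] {N n : ℕ} (X : Fin n → (Fin N → Ω))
    (x : Fin N → Ω) : ℝ :=
  ((Finset.univ.filter (fun i : Fin n => X i = x)).card : ℝ) / n

lemma aux_log_ge (x : ℝ) (hx : 1 ≤ x) : 0 ≤ (x + 1) * Real.log x - 2 * (x - 1) := by
  have h := Real.le_log_one_add_of_nonneg (x := x - 1) (by linarith)
  have e1 : (1 : ℝ) + (x - 1) = x := by ring
  have e2 : x - 1 + 2 = x + 1 := by ring
  rw [e1, e2, div_le_iff₀ (by linarith)] at h
  linarith

lemma aux_log_le (x : ℝ) (hx0 : 0 < x) (hx : x ≤ 1) :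
    (x + 1) * Real.log x - 2 * (x - 1) ≤ 0 := by
  have h := aux_log_ge x⁻¹ ((one_le_inv₀ hx0).2 hx)
  rw [Real.log_inv] at h
  have : x * ((x⁻¹ + 1) * -Real.log x - 2 * (x⁻¹ - 1))
      = -((x + 1) * Real.log x - 2 * (x - 1)) := by field_simp; ring
  have := mul_nonneg hx0.le h
  linarith

lemma aux_deriv (x : ℝ) (hx : 0 < x) :
    HasDerivAt (fun x : ℝ => (4 + 2 * x) * (x * Real.log x - x + 1) - 3 * (x - 1) ^ 2)
      (4 * ((x + 1) * Real.log x - 2 * (x - 1))) x := by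
  have hl := Real.hasDerivAt_log hx.ne'
  have hi := hasDerivAt_id x
  have h1 := ((hi.const_mul 2).const_add 4).mul (((hi.mul hl).sub hi).add_const 1)
  have h2 := ((hi.sub_const 1).pow 2).const_mul 3
  have h3 := h1.sub h2
  refine HasDerivAt.congr_deriv (f := fun x : ℝ =>
    (4 + 2 * x) * (x * Real.log x - x + 1) - 3 * (x - 1) ^ 2) h3 ?_
  simp only [Pi.mul_apply, Pi.sub_apply, id]
  field_simp
  push_cast
  ring

lemma aux_pinsker_scalar (x : ℝ) (hx : 0 < x) :
    3 * (x - 1) ^ 2 ≤ (4 + 2 * x) * (x * Real.log x - x + 1) := by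
  have key : (fun x : ℝ => (4 + 2 * x) * (x * Real.log x - x + 1) - 3 * (x - 1) ^ 2) 1 ≤
      (fun x : ℝ => (4 + 2 * x) * (x * Real.log x - x + 1) - 3 * (x - 1) ^ 2) x := by
    rcases le_total 1 x with h | h
    · refine (monotoneOn_of_deriv_nonneg
        (f := fun x : ℝ => (4 + 2 * x) * (x * Real.log x - x + 1) - 3 * (x - 1) ^ 2) (convex_Ici (1 : ℝ)) ?_ ?_ ?_) (Set.mem_Ici.2 le_rfl)
        (Set.mem_Ici.2 h) h
      · intro y hy
        exact (aux_deriv y (lt_of_lt_of_le one_pos hy)).continuousAt.continuousWithinAt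
      · intro y hy
        rw [interior_Ici] at hy
        exact (aux_deriv y (lt_trans one_pos hy)).differentiableAt.differentiableWithinAt
      · intro y hy
        rw [interior_Ici] at hy
        rw [(aux_deriv y (lt_trans one_pos hy)).deriv]
        have := aux_log_ge y (le_of_lt hy)
        linarith
    · refine (antitoneOn_of_deriv_nonpos
        (f := fun x : ℝ => (4 + 2 * x) * (x * Real.log x - x + 1) - 3 * (x - 1) ^ 2) (convex_Ioc (0 : ℝ) 1) ?_ ?_ ?_) ⟨hx, h⟩
        ⟨one_pos, le_rfl⟩ h
      · intro y hy
        exact (aux_deriv y hy.1).continuousAt.continuousWithinAt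
      · intro y hy
        rw [interior_Ioc] at hy
        exact (aux_deriv y hy.1).differentiableAt.differentiableWithinAt
      · intro y hy
        rw [interior_Ioc] at hy
        rw [(aux_deriv y hy.1).deriv]
        have := aux_log_le y hy.1 hy.2.le
        linarith
  simp at key
  linarith

lemma aux_pinsker_term (r q : ℝ) (hr : 0 ≤ r) (hq : 0 < q) :
    0 ≤ r * Real.log (r / q) - r + q ∧
    |q - r| ^ 2 ≤ ((4 * q + 2 * r) / 3) * (r * Real.log (r / q) - r + q) := by
  rcases hr.eq_or_lt with h | h
  · subst h
    simp
    exact ⟨hq.le, by nlinarith⟩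
  · have hx : 0 < r / q := div_pos h hq
    have e : r = (r / q) * q := by field_simp
    generalize r / q = x at *
    subst e
    have h1 := aux_pinsker_scalar x hx
    have e2 : x * q * Real.log x - x * q + q = q * (x * Real.log x - x + 1) := by ring
    rw [e2]
    constructor
    · have : 0 ≤ (4 + 2 * x) * (x * Real.log x - x + 1) := le_trans (by positivity) h1
      have := nonneg_of_mul_nonneg_right this (by positivity)
      positivity
    · rw [sq_abs]
      have := mul_le_mul_of_nonneg_left h1 (sq_nonneg q)
      nlinarith

lemma aux_pinsker {Ω : Type*} [Fintype Ω] {N : ℕ} (r q : (Fin N → Ω) → ℝ)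
    (hr0 : ∀ x, 0 ≤ r x) (hr1 : ∑ x, r x = 1) (hq0 : ∀ x, 0 < q x) (hq1 : ∑ x, q x = 1) :
    tvDist q r ≤ Real.sqrt ((1 / 2 : ℝ) * klFull r q) := by
  apply Real.le_sqrt_of_sq_le
  have h := Finset.sum_sq_le_sum_mul_sum_of_sq_le_mul Finset.univ
    (r := fun x => |q x - r x|) (f := fun x => (4 * q x + 2 * r x) / 3)
    (g := fun x => r x * Real.log (r x / q x) - r x + q x)
    (fun x _ => by have := hr0 x; have := hq0 x; positivity)
    (fun x _ => (aux_pinsker_term _ _ (hr0 x) (hq0 x)).1)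
    (fun x _ => (aux_pinsker_term _ _ (hr0 x) (hq0 x)).2)
  rw [← Finset.sum_div, Finset.sum_add_distrib, ← Finset.mul_sum, ← Finset.mul_sum,
    Finset.sum_add_distrib, Finset.sum_sub_distrib, hr1, hq1] at h
  unfold tvDist klFull
  rw [mul_pow]
  linarith

lemma aux_var_s12 {ι α : Type*} [Fintype ι] [DecidableEq ι] [Fintype α] (w f : ι → α → ℝ)
    (hw : ∀ i, ∑ a, w i a = 1) (hf : ∀ i, ∑ a, w i a * f i a = 0) :
    ∑ F : ι → α, (∏ i, w i (F i)) * (∑ i, f i (F i)) ^ 2 = ∑ i, ∑ a, w i a * f i a ^ 2 := by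
  have hprod : ∀ g : ι → α → ℝ, ∑ F : ι → α, ∏ k, g k (F k) = ∏ k, ∑ a, g k a := by
    intro g
    rw [Finset.prod_univ_sum, Fintype.piFinset_univ]
  have hij : ∀ i j, ∑ F : ι → α, (∏ k, w k (F k)) * (f i (F i) * f j (F j))
      = if i = j then ∑ a, w i a * f i a ^ 2 else 0 := by
    intro i j
    have e : ∀ F : ι → α, (∏ k, w k (F k)) * (f i (F i) * f j (F j))
        = ∏ k, (w k (F k) * ((if k = i then f i (F k) else 1) *
            (if k = j then f j (F k) else 1))) := by
      intro F
      rw [Finset.prod_mul_distrib, Finset.prod_mul_distrib, Finset.prod_ite_eq' Finset.univ i,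
        Finset.prod_ite_eq' Finset.univ j]
      simp
    simp_rw [e]
    rw [hprod (fun k a => w k a * ((if k = i then f i a else 1) * (if k = j then f j a else 1)))]
    by_cases h : i = j
    · subst h
      rw [if_pos rfl, Finset.prod_eq_single i]
      · simp [sq]
      · intro b _ hb
        simp [hb, hw]
      · simp
    · rw [if_neg h]
      apply Finset.prod_eq_zero (Finset.mem_univ i)
      simp [h, hf]
  calc _ = ∑ F : ι → α, ∑ i, ∑ j, (∏ k, w k (F k)) * (f i (F i) * f j (F j)) := by
        refine Finset.sum_congr rfl fun F _ => ?_
        rw [sq, Finset.sum_mul_sum, Finset.mul_sum]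
        simp_rw [Finset.mul_sum]
    _ = ∑ i, ∑ j, ∑ F : ι → α, (∏ k, w k (F k)) * (f i (F i) * f j (F j)) := by
        rw [Finset.sum_comm]
        refine Finset.sum_congr rfl fun i _ => ?_
        rw [Finset.sum_comm]
    _ = _ := by
        simp_rw [hij]
        simp

lemma aux_total {ι α : Type*} [Fintype ι] [DecidableEq ι] [Fintype α] (w : ι → α → ℝ)
    (hw : ∀ i, ∑ a, w i a = 1) : ∑ F : ι → α, (∏ i, w i (F i)) = 1 := by
  have := Finset.prod_univ_sum (fun _ : ι => (Finset.univ : Finset α)) w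
  rw [Fintype.piFinset_univ] at this
  rw [← this]
  simp [hw]

lemma aux_klCond {Ω : Type*} [Fintype Ω] {N : ℕ} (r q : (Fin N → Ω) → ℝ)
    (hr0 : ∀ x, 0 ≤ r x) (hq0 : ∀ x, 0 < q x) (β : ℝ) (hβ0 : 0 < β)
    (x : Fin N → Ω) (K : Finset (Fin N)) (hx : 0 < r x)
    (hm : ∀ y : Fin N → Ω, (∀ i ∉ K, y i = x i) → β ≤ condAt q x K y) :
    0 ≤ klCond r q x K ∧ klCond r q x K ≤ Real.log (1 / β) := by
  have hZ : ∀ r : (Fin N → Ω) → ℝ, (∀ x, 0 ≤ r x) → 0 < r x →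
      (∀ y, 0 ≤ condAt r x K y) ∧ ∑ y, condAt r x K y = 1 := by
    intro r hr0 hx
    have hnn : ∀ z : Fin N → Ω, 0 ≤ (if ∀ i ∉ K, z i = x i then r z else 0) := by
      intro z; split_ifs
      · exact hr0 z
      · exact le_rfl
    have hp : 0 < ∑ z : Fin N → Ω, (if ∀ i ∉ K, z i = x i then r z else 0) := by
      apply Finset.sum_pos' (fun z _ => hnn z)
      exact ⟨x, Finset.mem_univ _, by simpa using hx⟩
    constructor
    · intro y
      exact div_nonneg (hnn y) hp.le
    · unfold condAt
      rw [← Finset.sum_div, div_self hp.ne']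
  obtain ⟨r0, r1⟩ := hZ r hr0 hx
  obtain ⟨q0, q1⟩ := hZ q (fun x => (hq0 x).le) (hq0 x)
  have hqp : ∀ y, 0 < condAt r x K y → β ≤ condAt q x K y := by
    intro y hy
    apply hm
    by_contra hc
    unfold condAt at hy
    rw [if_neg hc] at hy
    simp at hy
  have hle : ∀ y, condAt r x K y ≤ 1 := by
    intro y
    rw [← r1]
    exact Finset.single_le_sum (fun z _ => r0 z) (Finset.mem_univ y)
  unfold klCond
  constructor
  · have : ∑ y, (condAt r x K y - condAt q x K y) ≤
        ∑ y : Fin N → Ω, condAt r x K y * Real.log (condAt r x K y / condAt q x K y) := by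
      refine Finset.sum_le_sum fun y _ => ?_
      rcases (r0 y).eq_or_lt with h | h
      · rw [← h]; simpa using q0 y
      · have := (aux_pinsker_term _ _ (r0 y) (lt_of_lt_of_le hβ0 (hqp y h))).1
        linarith
    rw [Finset.sum_sub_distrib, r1, q1] at this
    linarith
  · calc _ ≤ ∑ y, condAt r x K y * Real.log (1 / β) := by
          refine Finset.sum_le_sum fun y _ => ?_
          rcases (r0 y).eq_or_lt with h | h
          · rw [← h]; simp
          · have hb := hqp y h
            refine mul_le_mul_of_nonneg_left ?_ (r0 y)
            apply Real.log_le_log (div_pos h (lt_of_lt_of_le hβ0 hb))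
            exact div_le_div₀ zero_le_one (hle y) hβ0 hb
      _ = _ := by rw [← Finset.sum_mul, r1, one_mul]

lemma aux_var_bdd {α : Type*} [Fintype α] (w f : α → ℝ) (hw0 : ∀ a, 0 ≤ w a)
    (hw : ∑ a, w a = 1) (L : ℝ) (hf : ∀ a, 0 ≤ f a ∧ f a ≤ L) :
    ∑ a, w a * (f a - ∑ b, w b * f b) ^ 2 ≤ L ^ 2 / 4 := by
  set μ := ∑ b, w b * f b with hμ
  have h1 : ∑ a, w a * (f a - μ) ^ 2 ≤ ∑ a, (L * (w a * f a) - 2 * μ * (w a * f a) + μ ^ 2 * w a) := by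
    refine Finset.sum_le_sum fun a _ => ?_
    have := mul_nonneg (hw0 a) (mul_nonneg (hf a).1 (sub_nonneg.2 (hf a).2))
    nlinarith
  rw [Finset.sum_add_distrib, Finset.sum_sub_distrib, ← Finset.mul_sum, ← Finset.mul_sum,
    ← Finset.mul_sum, hw, ← hμ] at h1
  nlinarith [sq_nonneg (L - 2 * μ)]

lemma aux_emp_sum {Ω : Type*} [Fintype Ω] {N n : ℕ} (X : Fin n → (Fin N → Ω))
    (g : (Fin N → Ω) → ℝ) : ∑ x, empDist X x * g x = (1 / (n : ℝ)) * ∑ i, g (X i) := by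
  have e : ∀ x, empDist X x = (1 / (n : ℝ)) * ∑ i, (if X i = x then 1 else 0) := by
    intro x
    unfold empDist
    rw [Finset.card_filter]
    push_cast
    ring
  simp_rw [e, mul_assoc, ← Finset.mul_sum, Finset.sum_mul]
  rw [Finset.sum_comm]
  simp

/-- Chebyshev for the empirical distribution. -/
lemma aux_emp_var {Ω : Type*} [Fintype Ω] {N n : ℕ} (hn : 0 < n)
    (pX : (Fin N → Ω) → ℝ) (hpX0 : ∀ x, 0 ≤ pX x) (hpX1 : ∑ x, pX x = 1) :
    ∑ X : Fin n → (Fin N → Ω), (∏ i, pX (X i)) * tvDist (empDist X) pX ^ 2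
      ≤ ((Fintype.card Ω : ℝ) ^ N - 1) / (4 * n) := by
  have hn' : (0 : ℝ) < n := by exact_mod_cast hn
  have hcard : ((Finset.univ : Finset (Fin N → Ω)).card : ℝ) = (Fintype.card Ω : ℝ) ^ N := by
    rw [Finset.card_univ]; simp
  set A : ℝ := (Fintype.card Ω : ℝ) ^ N with hA
  have hA0 : 0 ≤ A := by positivity
  have hx : ∀ x, ∑ X : Fin n → (Fin N → Ω), (∏ i, pX (X i)) * (empDist X x - pX x) ^ 2
      = (pX x - pX x ^ 2) / n := by
    intro x
    have hv := aux_var_s12 (ι := Fin n) (fun _ y => pX y)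
      (fun _ y => (if y = x then (1 : ℝ) else 0) - pX x) (fun _ => hpX1) (by
        intro _
        simp [mul_sub, Finset.sum_sub_distrib, ← Finset.sum_mul, hpX1])
    have e : ∀ X : Fin n → (Fin N → Ω), empDist X x - pX x
        = (1 / (n : ℝ)) * ∑ i, ((if X i = x then (1 : ℝ) else 0) - pX x) := by
      intro X
      unfold empDist
      rw [Finset.card_filter, Finset.sum_sub_distrib]
      push_cast
      simp
      field_simp
    have e2 : ∑ y, pX y * ((if y = x then (1 : ℝ) else 0) - pX x) ^ 2 = pX x - pX x ^ 2 := by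
      have : ∀ y, pX y * ((if y = x then (1 : ℝ) else 0) - pX x) ^ 2
          = (if y = x then pX y * (1 - 2 * pX x) else 0) + pX y * pX x ^ 2 := by
        intro y
        split_ifs <;> ring
      simp_rw [this]
      rw [Finset.sum_add_distrib, ← Finset.sum_mul, hpX1]
      simp
      ring
    simp_rw [e, mul_pow, mul_left_comm _ ((1 / (n : ℝ)) ^ 2)]
    rw [← Finset.mul_sum, hv]
    simp only [e2]
    simp
    field_simp
  have hW : ∀ X : Fin n → (Fin N → Ω), 0 ≤ ∏ i, pX (X i) :=
    fun X => Finset.prod_nonneg fun i _ => hpX0 _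
  have hcs : 1 ≤ A * ∑ x, pX x ^ 2 := by
    have := sq_sum_le_card_mul_sum_sq (s := (Finset.univ : Finset (Fin N → Ω))) (f := pX)
    rw [hpX1, hcard] at this
    simpa using this
  calc _ ≤ ∑ X : Fin n → (Fin N → Ω), ∑ x,
        A / 4 * ((∏ i, pX (X i)) * (empDist X x - pX x) ^ 2) := by
        refine Finset.sum_le_sum fun X _ => ?_
        have := sq_sum_le_card_mul_sum_sq (s := (Finset.univ : Finset (Fin N → Ω)))
          (f := fun x => |empDist X x - pX x|)
        simp_rw [sq_abs] at this
        rw [hcard] at this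
        rw [← Finset.mul_sum, ← Finset.mul_sum]
        unfold tvDist
        have := mul_le_mul_of_nonneg_left this (hW X)
        rw [mul_pow]
        linarith
    _ = A / 4 * ((1 - ∑ x, pX x ^ 2) / n) := by
        rw [Finset.sum_comm]
        simp_rw [← Finset.mul_sum, hx]
        rw [← Finset.sum_div, Finset.sum_sub_distrib, hpX1]
    _ ≤ _ := by
        rw [div_mul_div_comm]
        gcongr
        linarith

lemma aux_mask_var {κ : Type*} [Fintype κ] {n m : ℕ} (hn : 0 < n) (hm : 0 < m)
    (w k : Fin n → κ → ℝ) (hw0 : ∀ i a, 0 ≤ w i a) (hw1 : ∀ i, ∑ a, w i a = 1)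
    (L : ℝ) (hk : ∀ i a, 0 ≤ k i a ∧ k i a ≤ L) :
    ∑ M : Fin n → Fin m → κ, (∏ i, ∏ j, w i (M i j)) *
      (((1 : ℝ) / n) * ∑ i, ((1 : ℝ) / m) * ∑ j, k i (M i j)
        - (1 / (n : ℝ)) * ∑ i, ∑ a, w i a * k i a) ^ 2 ≤ L ^ 2 / (4 * n * m) := by
  have hn' : (0 : ℝ) < n := by exact_mod_cast hn
  have hm' : (0 : ℝ) < m := by exact_mod_cast hm
  have hv := aux_var_s12 (ι := Fin n × Fin m) (fun ij a => w ij.1 a)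
    (fun ij a => k ij.1 a - ∑ b, w ij.1 b * k ij.1 b) (fun ij => hw1 _) (by
      intro ij
      simp [mul_sub, Finset.sum_sub_distrib, ← Finset.sum_mul, hw1])
  have hb : ∑ ij : Fin n × Fin m, ∑ a, w ij.1 a * (k ij.1 a - ∑ b, w ij.1 b * k ij.1 b) ^ 2
      ≤ n * m * (L ^ 2 / 4) := by
    calc _ ≤ ∑ _ij : Fin n × Fin m, L ^ 2 / 4 :=
          Finset.sum_le_sum fun ij _ => aux_var_bdd _ _ (hw0 _) (hw1 _) L (hk _)
      _ = _ := by simp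
  rw [← hv] at hb
  have e : ∑ M : Fin n → Fin m → κ, (∏ i, ∏ j, w i (M i j)) *
      (((1 : ℝ) / n) * ∑ i, ((1 : ℝ) / m) * ∑ j, k i (M i j)
        - (1 / (n : ℝ)) * ∑ i, ∑ a, w i a * k i a) ^ 2
      = (1 / ((n : ℝ) * m)) ^ 2 * ∑ F : Fin n × Fin m → κ, (∏ ij, w ij.1 (F ij)) *
        (∑ ij, (k ij.1 (F ij) - ∑ b, w ij.1 b * k ij.1 b)) ^ 2 := by
    symm
    rw [Finset.mul_sum]
    apply Fintype.sum_equiv (Equiv.curry (Fin n) (Fin m) κ)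
    intro F
    symm
    rw [mul_left_comm, ← mul_pow, Fintype.prod_prod_type, Fintype.sum_prod_type]
    simp only [Equiv.curry_apply, Function.curry]
    congr 2
    simp_rw [Finset.sum_sub_distrib]
    rw [← Finset.mul_sum]
    simp only [Finset.sum_const, Finset.card_univ, Fintype.card_fin, nsmul_eq_mul]
    rw [← Finset.mul_sum]
    field_simp
  rw [e]
  calc _ ≤ (1 / ((n : ℝ) * m)) ^ 2 * (n * m * (L ^ 2 / 4)) := by gcongr
    _ = _ := by field_simp

lemma aux_cheb_s12 {α : Type*} [Fintype α] (W D : α → ℝ) (hW : ∀ a, 0 ≤ W a) (s V : ℝ) (hs : 0 < s)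
    (h : ∑ a, W a * D a ^ 2 ≤ V) (p : ℝ) (hV : V ≤ p * s ^ 2) :
    ∑ a, W a * (if s ≤ D a then (1 : ℝ) else 0) ≤ p := by
  have : (∑ a, W a * (if s ≤ D a then (1 : ℝ) else 0)) * s ^ 2 ≤ p * s ^ 2 := by
    refine le_trans ?_ (h.trans hV)
    rw [Finset.sum_mul]
    refine Finset.sum_le_sum fun a _ => ?_
    rw [mul_assoc]
    refine mul_le_mul_of_nonneg_left ?_ (hW a)
    split_ifs with h
    · rw [one_mul]; gcongr
    · rw [zero_mul]; positivity
  exact le_of_mul_le_mul_right this (by positivity)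

/-- **Generalization bound for learning the joint distribution.**
Under the support-margin assumption (constant `β`) for all parameters, the complexity
assumption (a partition of the parameter space into `C` pieces within which both the
empirical loss `L̂_PL` and the loss `L̃_PL` vary by at most `ε/2`), and assuming that the
constant `C̄_AT(p_θ̂) ≥ 0` satisfies the block-generalized approximate-tensorization
inequality `D_KL(π ‖ p_θ̂) ≤ C̄_AT(p_θ̂) · E_{X∼π} E_{K∼p_K(·|X)}[D_KL(π(·|X_{-K},K) ‖
p_θ̂(·|X_{-K},K))]` for `π ∈ {p_X, p̃}`, for every `δ ∈ (0,1)` we have, with probability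
at least `1 - δ` over the training data, the stated total-variation bound between the
estimated model `p_θ̂` and the data distribution `p_X`. -/
theorem generalization_bound_joint
    {Ω : Type*} [Fintype Ω] {N n m : ℕ} (hn : 0 < n) (hm : 0 < m)
    {P : Type*}
    (pX : (Fin N → Ω) → ℝ) (hpX0 : ∀ x, 0 ≤ pX x) (hpX1 : ∑ x, pX x = 1)
    (pK : (Fin N → Ω) → Finset (Fin N) → ℝ) (hpK0 : ∀ x K, 0 ≤ pK x K)
    (hpK1 : ∀ x, ∑ K : Finset (Fin N), pK x K = 1)
    -- the parametric family θ ↦ p_θ of strictly positive distributions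
    (q : P → (Fin N → Ω) → ℝ) (hq0 : ∀ θ x, 0 < q θ x) (hq1 : ∀ θ, ∑ x, q θ x = 1)
    -- support-margin assumption, for all parameters
    (β : ℝ) (hβ0 : 0 < β) (hβ1 : β ≤ 1)
    (hmargin : ∀ (θ : P) (x : Fin N → Ω) (K : Finset (Fin N)) (y : Fin N → Ω),
      (∀ i ∉ K, y i = x i) → β ≤ condAt (q θ) x K y)
    -- the empirical loss L̂_PL (p̃ = empirical distribution of the sample) and
    -- the loss L̃_PL(θ) = E_{X∼p̃} E_{K∼p_K(·|X)}[D_KL(p̃(·|X_{-K},K) ‖ p_θ(·|X_{-K},K))]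
    (Lhat Ltilde :
      (Fin n → (Fin N → Ω)) → (Fin n → Fin m → Finset (Fin N)) → P → ℝ)
    (hLhat : ∀ X M θ, Lhat X M θ
      = ((1 : ℝ) / n) * ∑ i, ((1 : ℝ) / m) * ∑ j, klCond (empDist X) (q θ) (X i) (M i j))
    (hLtilde : ∀ X M θ, Ltilde X M θ
      = ∑ x, empDist X x * ∑ K : Finset (Fin N), pK x K * klCond (empDist X) (q θ) x K)
    -- complexity assumption: a partition of P into C pieces with oscillation ≤ ε/2
    (ε : ℝ) (hε : 0 < ε)
    (C : ℕ) (hC : 0 < C) (parts : Fin C → Set P)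
    (hcover : ∀ θ : P, ∃ a, θ ∈ parts a)
    (hoscTilde : ∀ X M (a : Fin C), ∀ θ₁ ∈ parts a, ∀ θ₂ ∈ parts a,
      |Ltilde X M θ₁ - Ltilde X M θ₂| ≤ ε / 2)
    (hoscHat : ∀ X M (a : Fin C), ∀ θ₁ ∈ parts a, ∀ θ₂ ∈ parts a,
      |Lhat X M θ₁ - Lhat X M θ₂| ≤ ε / 2)
    -- the estimator θ̂, measurable in the data
    (θhat : (Fin n → (Fin N → Ω)) → (Fin n → Fin m → Finset (Fin N)) → P)
    -- the approximate-tensorization constant C̄_AT(p_θ̂) ≥ 0, valid for π ∈ {p_X, p̃}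
    (CAT : P → ℝ) (hCAT0 : ∀ θ, 0 ≤ CAT θ)
    (hAT : ∀ X M,
      (klFull pX (q (θhat X M))
          ≤ CAT (θhat X M) *
            ∑ x, pX x * ∑ K : Finset (Fin N), pK x K * klCond pX (q (θhat X M)) x K)
      ∧ (klFull (empDist X) (q (θhat X M))
          ≤ CAT (θhat X M) *
            ∑ x, empDist X x *
              ∑ K : Finset (Fin N), pK x K * klCond (empDist X) (q (θhat X M)) x K))
    (δ : ℝ) (hδ0 : 0 < δ) (hδ1 : δ < 1) :
    1 - δ ≤
      ∑ X : Fin n → (Fin N → Ω), ∑ M : Fin n → Fin m → Finset (Fin N),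
        ((∏ i, pX (X i)) * ∏ i, ∏ j, pK (X i) (M i j)) *
          (if
              tvDist (q (θhat X M)) pX
                < Real.sqrt ((1 / 2 : ℝ) * CAT (θhat X M) *
                    (Lhat X M (θhat X M)
                      + (Real.sqrt
                            ((2 : ℝ) ^ (3 * N) * (Fintype.card Ω : ℝ) ^ N * C / (m * δ))
                          + Real.sqrt (Real.log (8 * C / δ) / (2 * n)))
                          * Real.log (1 / β)
                      + ε))
                  + Real.sqrt ((Fintype.card Ω : ℝ) ^ (3 * N) / (8 * δ * n))
           then 1 else 0) := by
  have hn' : (0 : ℝ) < n := by exact_mod_cast hn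
  have hm' : (0 : ℝ) < m := by exact_mod_cast hm
  have hC' : (0 : ℝ) < C := by exact_mod_cast hC
  have hn1 : (1 : ℝ) ≤ n := by exact_mod_cast hn
  set A : ℝ := (Fintype.card Ω : ℝ) ^ N with hA
  have hne : Nonempty (Fin N → Ω) := by
    by_contra hcon
    rw [not_nonempty_iff] at hcon
    simp at hpX1
  have hA1 : 1 ≤ A := by
    have h1 : 1 ≤ Fintype.card (Fin N → Ω) := Fintype.card_pos
    have h2 : Fintype.card (Fin N → Ω) = Fintype.card Ω ^ N := by simp
    rw [h2] at h1
    rw [hA]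
    exact_mod_cast h1
  have hA2 : A = 1 ∨ 2 ≤ A := by
    have h1 : 1 ≤ Fintype.card Ω ^ N := by
      have h2 : ((Fintype.card Ω ^ N : ℕ) : ℝ) = A := by rw [hA]; push_cast; rfl
      rw [← h2] at hA1
      exact_mod_cast hA1
    rcases h1.eq_or_lt with h | h
    · left
      rw [hA]; exact_mod_cast h.symm
    · right
      rw [hA]; exact_mod_cast h
  have hA3 : (Fintype.card Ω : ℝ) ^ (3 * N) = A ^ 3 := by
    rw [hA, ← pow_mul, mul_comm]
  rw [hA3]
  set L : ℝ := Real.log (1 / β) with hL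
  have hL0 : 0 ≤ L := Real.log_nonneg (by rw [le_div_iff₀ hβ0]; linarith)
  set s : ℝ := (Real.sqrt ((2 : ℝ) ^ (3 * N) * A * C / (m * δ))
      + Real.sqrt (Real.log (8 * C / δ) / (2 * n))) * L with hs
  set t : ℝ := Real.sqrt (A ^ 3 / (8 * δ * n)) with ht
  have ht0 : 0 < t := Real.sqrt_pos.2 (by positivity)
  have ht2 : t ^ 2 = A ^ 3 / (8 * δ * n) := Real.sq_sqrt (by positivity)
  have hs2 : (2 : ℝ) ^ (3 * N) * A * C / (m * δ) * L ^ 2 ≤ s ^ 2 := by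
    rw [hs, mul_pow]
    have h1 : (Real.sqrt ((2 : ℝ) ^ (3 * N) * A * C / (m * δ))) ^ 2
        = (2 : ℝ) ^ (3 * N) * A * C / (m * δ) := Real.sq_sqrt (by positivity)
    refine mul_le_mul_of_nonneg_right ?_ (sq_nonneg L)
    refine h1.symm.le.trans ?_
    gcongr
    linarith [Real.sqrt_nonneg (Real.log (8 * C / δ) / (2 * n))]
  have hs0 : 0 ≤ s := by positivity
  have hspos : 0 < L → 0 < s := by
    intro h
    have : 0 < (2 : ℝ) ^ (3 * N) * A * C / (m * δ) * L ^ 2 := by positivity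
    have h2 := this.trans_le hs2
    exact lt_of_le_of_ne hs0 (fun h => by rw [← h] at h2; simp at h2)
  -- the empirical distribution
  have hemp0 : ∀ (X : Fin n → (Fin N → Ω)) x, 0 ≤ empDist X x := by
    intro X x; unfold empDist; positivity
  have hemp1 : ∀ (X : Fin n → (Fin N → Ω)), ∑ x, empDist X x = 1 := by
    intro X
    have := aux_emp_sum X (fun _ => 1)
    simp only [mul_one] at this
    rw [this]
    simp
    field_simp
  have hempX : ∀ (X : Fin n → (Fin N → Ω)) i, 0 < empDist X (X i) := by
    intro X i; unfold empDist
    apply div_pos _ hn'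
    exact_mod_cast Finset.card_pos.2 ⟨i, by simp⟩
  have hk : ∀ (X : Fin n → (Fin N → Ω)) θ i K, 0 ≤ klCond (empDist X) (q θ) (X i) K ∧
      klCond (empDist X) (q θ) (X i) K ≤ L := fun X θ i K =>
    aux_klCond _ _ (hemp0 X) (hq0 θ) β hβ0 (X i) K (hempX X i) (hmargin θ (X i) K)
  have hLt : ∀ X M θ, Ltilde X M θ
      = (1 / (n : ℝ)) * ∑ i, ∑ K, pK (X i) K * klCond (empDist X) (q θ) (X i) K := by
    intro X M θ
    rw [hLtilde]
    exact aux_emp_sum X (fun x => ∑ K, pK x K * klCond (empDist X) (q θ) x K)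
  have hWM : ∀ (X : Fin n → (Fin N → Ω)) (M : Fin n → Fin m → Finset (Fin N)),
      0 ≤ ∏ i, ∏ j, pK (X i) (M i j) := fun X M =>
    Finset.prod_nonneg fun i _ => Finset.prod_nonneg fun j _ => hpK0 _ _
  have hWX : ∀ (X : Fin n → (Fin N → Ω)), 0 ≤ ∏ i, pX (X i) := fun X =>
    Finset.prod_nonneg fun i _ => hpX0 _
  have hWX1 : ∑ X : Fin n → (Fin N → Ω), ∏ i, pX (X i) = 1 :=
    aux_total (fun _ => pX) (fun _ => hpX1)
  have hWM1 : ∀ X : Fin n → (Fin N → Ω), ∑ M : Fin n → Fin m → Finset (Fin N),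
      ∏ i, ∏ j, pK (X i) (M i j) = 1 := fun X =>
    aux_total (α := Fin m → Finset (Fin N)) (fun i F => ∏ j, pK (X i) (F j))
      (fun i => aux_total (fun _ => pK (X i)) (fun _ => hpK1 _))
  -- concentration over the masks
  have hmask : ∀ (X : Fin n → (Fin N → Ω)) (θ : P),
      ∑ M : Fin n → Fin m → Finset (Fin N), (∏ i, ∏ j, pK (X i) (M i j)) *
        (if s < Ltilde X M θ - Lhat X M θ then (1 : ℝ) else 0) ≤ δ / (4 * C) := by
    intro X θ
    rcases hL0.eq_or_lt with h | h
    · have hz : ∀ i K, klCond (empDist X) (q θ) (X i) K = 0 := fun i K =>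
        le_antisymm ((hk X θ i K).2.trans h.symm.le) (hk X θ i K).1
      have : ∀ M, ¬ s < Ltilde X M θ - Lhat X M θ := by
        intro M
        rw [hLt, hLhat]
        simp [hz, hs0]
      simp only [this, if_false, mul_zero, Finset.sum_const_zero]
      positivity
    · have hv := aux_mask_var hn hm (fun i K => pK (X i) K)
        (fun i K => klCond (empDist X) (q θ) (X i) K) (fun i => hpK0 _) (fun i => hpK1 _) L
        (hk X θ)
      have hc := aux_cheb_s12 (fun M : Fin n → Fin m → Finset (Fin N) => ∏ i, ∏ j, pK (X i) (M i j))
        (fun M => Ltilde X M θ - Lhat X M θ) (hWM X) s (L ^ 2 / (4 * n * m)) (hspos h) (by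
          refine le_trans (le_of_eq ?_) hv
          refine Finset.sum_congr rfl fun M _ => ?_
          rw [hLt, hLhat]
          ring) (δ / (4 * C)) (by
          have h2 : (1 : ℝ) ≤ 2 ^ (3 * N) := one_le_pow₀ (by norm_num)
          calc L ^ 2 / (4 * n * m) ≤ L ^ 2 / (4 * 1 * m) := by gcongr
            _ = δ / (4 * C) * (1 * 1 * C / (m * δ) * L ^ 2) := by field_simp
            _ ≤ δ / (4 * C) * ((2 : ℝ) ^ (3 * N) * A * C / (m * δ) * L ^ 2) := by gcongr
            _ ≤ _ := by gcongr)
      refine le_trans ?_ hc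
      refine Finset.sum_le_sum fun M _ => ?_
      refine mul_le_mul_of_nonneg_left ?_ (hWM X M)
      by_cases hlt : s < Ltilde X M θ - Lhat X M θ
      · rw [if_pos hlt, if_pos hlt.le]
      · rw [if_neg hlt]; split_ifs <;> norm_num
  -- concentration of the empirical distribution
  have htv : ∑ X : Fin n → (Fin N → Ω), (∏ i, pX (X i)) *
      (if t ≤ tvDist (empDist X) pX then (1 : ℝ) else 0) ≤ δ / 4 := by
    refine aux_cheb_s12 _ _ hWX t _ ht0 (aux_emp_var hn pX hpX0 hpX1) _ ?_
    have hA4 : 8 * (A - 1) ≤ A ^ 3 := by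
      rcases hA2 with h | h
      · rw [h]; norm_num
      · nlinarith [mul_nonneg (sub_nonneg.2 h) (by nlinarith : (0 : ℝ) ≤ A ^ 2 + 2 * A - 4)]
    rw [ht2]
    have : δ / 4 * (A ^ 3 / (8 * δ * n)) = (A ^ 3 / 8) / (4 * n) := by field_simp
    rw [this]
    gcongr
    linarith
  -- representatives
  have hP : Nonempty P := ⟨θhat (fun _ => hne.some) (fun _ _ => ∅)⟩
  have hrep : ∀ a : Fin C, ∃ θ : P, (parts a).Nonempty → θ ∈ parts a := by
    intro a
    by_cases h : (parts a).Nonempty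
    · exact ⟨h.some, fun _ => h.some_mem⟩
    · exact ⟨hP.some, fun h' => absurd h' h⟩
  choose rep hrep using hrep
  -- pointwise bound
  have hpt : ∀ (X : Fin n → (Fin N → Ω)) (M : Fin n → Fin m → Finset (Fin N)),
      ¬ t ≤ tvDist (empDist X) pX →
      (∀ a, ¬ s < Ltilde X M (rep a) - Lhat X M (rep a)) →
      tvDist (q (θhat X M)) pX < Real.sqrt ((1 / 2 : ℝ) * CAT (θhat X M) *
        (Lhat X M (θhat X M) + s + ε)) + t := by
    intro X M h1 h2
    push Not at h1
    obtain ⟨a, ha⟩ := hcover (θhat X M)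
    have hra := hrep a ⟨_, ha⟩
    have o1 := (abs_le.1 (hoscTilde X M a _ ha _ hra)).2
    have o2 := (abs_le.1 (hoscHat X M a _ ha _ hra)).1
    have h2a := not_lt.1 (h2 a)
    have hle : Ltilde X M (θhat X M) ≤ Lhat X M (θhat X M) + s + ε := by linarith
    have htri : tvDist (q (θhat X M)) pX
        ≤ tvDist (q (θhat X M)) (empDist X) + tvDist (empDist X) pX := by
      unfold tvDist
      rw [← mul_add, ← Finset.sum_add_distrib]
      gcongr
      exact abs_sub_le _ _ _
    have hp := aux_pinsker (empDist X) (q (θhat X M)) (hemp0 X) (hemp1 X) (hq0 _) (hq1 _)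
    have hat := (hAT X M).2
    rw [← hLtilde X M] at hat
    have hsq : Real.sqrt ((1 / 2 : ℝ) * klFull (empDist X) (q (θhat X M))) ≤
        Real.sqrt ((1 / 2 : ℝ) * CAT (θhat X M) * (Lhat X M (θhat X M) + s + ε)) := by
      apply Real.sqrt_le_sqrt
      have := mul_le_mul_of_nonneg_left hle (hCAT0 (θhat X M))
      linarith
    linarith
  -- assembly
  have hfin : ∑ X : Fin n → (Fin N → Ω), ∑ M : Fin n → Fin m → Finset (Fin N),
      ((∏ i, pX (X i)) * ∏ i, ∏ j, pK (X i) (M i j)) *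
        (1 - (if t ≤ tvDist (empDist X) pX then (1 : ℝ) else 0)
          - ∑ a, (if s < Ltilde X M (rep a) - Lhat X M (rep a) then (1 : ℝ) else 0))
      ≥ 1 - δ / 4 - δ / 4 := by
    have e : ∀ X : Fin n → (Fin N → Ω), ∑ M : Fin n → Fin m → Finset (Fin N),
      ((∏ i, pX (X i)) * ∏ i, ∏ j, pK (X i) (M i j)) *
        (1 - (if t ≤ tvDist (empDist X) pX then (1 : ℝ) else 0)
          - ∑ a, (if s < Ltilde X M (rep a) - Lhat X M (rep a) then (1 : ℝ) else 0))
      = (∏ i, pX (X i)) - (∏ i, pX (X i)) * (if t ≤ tvDist (empDist X) pX then (1 : ℝ) else 0)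
        - (∏ i, pX (X i)) * ∑ a, ∑ M : Fin n → Fin m → Finset (Fin N),
          (∏ i, ∏ j, pK (X i) (M i j)) *
          (if s < Ltilde X M (rep a) - Lhat X M (rep a) then (1 : ℝ) else 0) := by
      intro X
      rw [Finset.sum_comm]
      simp_rw [← Finset.mul_sum, mul_assoc]
      rw [← Finset.mul_sum]
      simp_rw [mul_sub]
      rw [Finset.sum_sub_distrib, Finset.sum_sub_distrib, ← Finset.sum_mul, ← Finset.sum_mul,
        hWM1]
      ring
    simp_rw [e]
    rw [Finset.sum_sub_distrib, Finset.sum_sub_distrib, hWX1]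
    have h3 : ∑ X : Fin n → (Fin N → Ω), (∏ i, pX (X i)) *
        ∑ a, ∑ M : Fin n → Fin m → Finset (Fin N), (∏ i, ∏ j, pK (X i) (M i j)) *
          (if s < Ltilde X M (rep a) - Lhat X M (rep a) then (1 : ℝ) else 0)
        ≤ ∑ X : Fin n → (Fin N → Ω), (∏ i, pX (X i)) * (δ / 4) := by
      refine Finset.sum_le_sum fun X _ => mul_le_mul_of_nonneg_left ?_ (hWX X)
      calc _ ≤ ∑ a : Fin C, δ / (4 * C) := Finset.sum_le_sum fun a _ => hmask X (rep a)
        _ = _ := by simp; field_simp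
    rw [← Finset.sum_mul, hWX1] at h3
    linarith
  refine le_trans (by linarith : 1 - δ ≤ 1 - δ / 4 - δ / 4) (le_trans hfin ?_)
  refine Finset.sum_le_sum fun X _ => Finset.sum_le_sum fun M _ => ?_
  refine mul_le_mul_of_nonneg_left ?_ (mul_nonneg (hWX X) (hWM X M))
  have hsum0 : ∀ a, (0 : ℝ) ≤
      (if s < Ltilde X M (rep a) - Lhat X M (rep a) then (1 : ℝ) else 0) := by
    intro a; split_ifs <;> norm_num
  by_cases h1 : t ≤ tvDist (empDist X) pX
  · rw [if_pos h1]
    have := Finset.sum_nonneg (s := Finset.univ) fun a _ => hsum0 a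
    split_ifs <;> linarith
  · by_cases h2 : ∀ a, ¬ s < Ltilde X M (rep a) - Lhat X M (rep a)
    · rw [if_pos (hpt X M h1 h2), if_neg h1]
      have := Finset.sum_nonneg (s := Finset.univ) fun a _ => hsum0 a
      linarith
    · push Not at h2
      obtain ⟨a, ha⟩ := h2
      have := Finset.single_le_sum (fun b _ => hsum0 b) (Finset.mem_univ a)
      rw [if_pos ha] at this
      rw [if_neg h1]
      split_ifs <;> linarith
end
end

section
/- Modes of the strongly ferromagnetic Ising model, part 1 (mode ordering): Let p_G be the Ising distribution on {−1,1}^N with clique C_G ⊆ [N] (|C_G| ≥ 2), coupling J on pairs in C_G, and external fields h ∈ ℝ^N. Assume Σ_{i∈C_G} h_i > Σ_{i∉C_G} |h_i| and J − ‖h‖₁ ≥ J₀ > 0. Let R₁ = {x : x_i = 1 ∀ i ∈ C_G} and R₋₁ = {x : x_i = −1 ∀ i ∈ C_G}. Then for all x ∈ R₁, y ∈ R₋₁, and z ∈ {−1,1}^N \ (R₁ ∪ R₋₁): p_G(x) > p_G(y) and p_G(y) ≥ e^{2J₀} p_G(z). -/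
open scoped Classical BigOperators

noncomputable section

/-- The spin value of a Boolean: `true ↦ 1`, `false ↦ -1`. -/
def spin (b : Bool) : ℝ := if b then 1 else -1

/-- The energy (negative Hamiltonian) of the Ising model with clique `C`, coupling `J`
(counted once per unordered pair of distinct clique vertices) and fields `h`. -/
def isingEnergy {N : ℕ} (C : Finset (Fin N)) (J : ℝ) (h : Fin N → ℝ)
    (x : Fin N → Bool) : ℝ :=
  (∑ i, h i * spin (x i))
    + ∑ i ∈ C, ∑ j ∈ C, (if i < j then J * spin (x i) * spin (x j) else 0)

/-- The Ising distribution `p_G` with clique `C`, coupling `J` and fields `h`. -/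
def isingP {N : ℕ} (C : Finset (Fin N)) (J : ℝ) (h : Fin N → ℝ)
    (x : Fin N → Bool) : ℝ :=
  Real.exp (isingEnergy C J h x) / ∑ y : Fin N → Bool, Real.exp (isingEnergy C J h y)

lemma field_le {N : ℕ} (h : Fin N → ℝ) (x y : Fin N → Bool) (i : Fin N) :
    h i * spin (x i) ≤ h i * spin (y i) + 2 * |h i| := by
  have h1 := le_abs_self (h i)
  have h2 := neg_abs_le (h i)
  have h3 := abs_nonneg (h i)
  cases x i <;> cases y i <;> simp [spin] <;> linarith

lemma pair_le (J : ℝ) (hJ : 0 < J) (a b : Bool) : J * spin a * spin b ≤ J := by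
  cases a <;> cases b <;> simp [spin] <;> linarith

lemma inter_gap {N : ℕ} (C : Finset (Fin N)) (J : ℝ) (hJ : 0 < J) (z : Fin N → Bool)
    (a b : Fin N) (ha : a ∈ C) (hb : b ∈ C) (hab : a < b) (hne : z a ≠ z b) :
    (∑ i ∈ C, ∑ j ∈ C, (if i < j then J * spin (z i) * spin (z j) else 0)) + 2 * J
      ≤ ∑ i ∈ C, ∑ j ∈ C, (if i < j then J else 0) := by
  rw [← Finset.sum_product', ← Finset.sum_product',
    ← Finset.add_sum_erase (C ×ˢ C) _ (Finset.mk_mem_product ha hb),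
    ← Finset.add_sum_erase (C ×ˢ C) (fun p : Fin N × Fin N => if p.1 < p.2 then J else 0)
      (Finset.mk_mem_product ha hb)]
  have h1 : ∑ p ∈ (C ×ˢ C).erase (a, b),
      (if p.1 < p.2 then J * spin (z p.1) * spin (z p.2) else 0)
      ≤ ∑ p ∈ (C ×ˢ C).erase (a, b), (if p.1 < p.2 then J else 0) := by
    apply Finset.sum_le_sum
    intro p _
    split_ifs
    · exact pair_le J hJ _ _
    · exact le_rfl
  have h2 : J * spin (z a) * spin (z b) = -J := by
    revert hne
    cases z a <;> cases z b <;> simp [spin]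
  simp only [hab, if_true, h2]
  linarith

lemma inter_const {N : ℕ} (C : Finset (Fin N)) (J : ℝ) (x : Fin N → Bool) (c : Bool)
    (hx : ∀ i ∈ C, x i = c) :
    (∑ i ∈ C, ∑ j ∈ C, (if i < j then J * spin (x i) * spin (x j) else 0))
      = ∑ i ∈ C, ∑ j ∈ C, (if i < j then J else 0) := by
  refine Finset.sum_congr rfl fun i hi => Finset.sum_congr rfl fun j hj => ?_
  rw [hx i hi, hx j hj]
  cases c <;> simp [spin]

/-- **Modes of the strongly ferromagnetic Ising model, part 1 (mode ordering).**
Assume `Σ_{i∈C} h_i > Σ_{i∉C} |h_i|` and `J - ‖h‖₁ ≥ J₀ > 0`.  Then for all `x ∈ R₁`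
(all clique spins `+1`), `y ∈ R₋₁` (all clique spins `-1`), and `z ∉ R₁ ∪ R₋₁`:
`p_G(x) > p_G(y)` and `p_G(y) ≥ e^{2J₀} p_G(z)`. -/
theorem ising_mode_ordering
    {N : ℕ} (C : Finset (Fin N)) (hC : 2 ≤ C.card)
    (J J₀ : ℝ) (hJ : 0 < J) (h : Fin N → ℝ)
    (hfield : ∑ i ∈ Finset.univ \ C, |h i| < ∑ i ∈ C, h i)
    (hJ₀ : 0 < J₀) (hgap : J₀ ≤ J - ∑ i, |h i|)
    (x y z : Fin N → Bool)
    (hx : ∀ i ∈ C, x i = true)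
    (hy : ∀ i ∈ C, y i = false)
    (hz₁ : ¬ (∀ i ∈ C, z i = true)) (hz₂ : ¬ (∀ i ∈ C, z i = false)) :
    isingP C J h y < isingP C J h x
      ∧ Real.exp (2 * J₀) * isingP C J h z ≤ isingP C J h y := by
  have hZ : 0 < ∑ y : Fin N → Bool, Real.exp (isingEnergy C J h y) :=
    Finset.sum_pos (fun _ _ => Real.exp_pos _) Finset.univ_nonempty
  constructor
  · unfold isingP
    apply div_lt_div_of_pos_right _ hZ
    apply Real.exp_lt_exp.mpr
    unfold isingEnergy
    rw [inter_const C J x true hx, inter_const C J y false hy]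
    have e := fun f : Fin N → ℝ => Finset.sum_sdiff (f := f) (Finset.subset_univ C)
    rw [← e, ← e (fun i => h i * spin (x i))]
    have h1 : ∑ i ∈ C, h i * spin (x i) = ∑ i ∈ C, h i :=
      Finset.sum_congr rfl fun i hi => by simp [hx i hi, spin]
    have h2 : ∑ i ∈ C, h i * spin (y i) = - ∑ i ∈ C, h i := by
      rw [← Finset.sum_neg_distrib]
      exact Finset.sum_congr rfl fun i hi => by simp [hy i hi, spin]
    have h3 : ∑ i ∈ Finset.univ \ C, h i * spin (y i)
        ≤ ∑ i ∈ Finset.univ \ C, (h i * spin (x i) + 2 * |h i|) :=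
      Finset.sum_le_sum fun i _ => field_le h y x i
    rw [Finset.sum_add_distrib, ← Finset.mul_sum] at h3
    linarith
  · unfold isingP
    rw [← mul_div_assoc, ← Real.exp_add]
    apply div_le_div_of_nonneg_right _ hZ.le
    apply Real.exp_le_exp.mpr
    unfold isingEnergy
    rw [inter_const C J y false hy]
    have h3 : ∑ i, h i * spin (z i) ≤ ∑ i, (h i * spin (y i) + 2 * |h i|) :=
      Finset.sum_le_sum fun i _ => field_le h z y i
    rw [Finset.sum_add_distrib, ← Finset.mul_sum] at h3
    push Not at hz₁ hz₂
    obtain ⟨a, ha, hza⟩ := hz₁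
    obtain ⟨b, hb, hzb⟩ := hz₂
    have hne : z a ≠ z b := by
      revert hza hzb
      cases z a <;> cases z b <;> simp
    have hab : a ≠ b := fun hh => hne (by rw [hh])
    rcases lt_or_gt_of_ne hab with hl | hl
    · have := inter_gap C J hJ z a b ha hb hl hne
      linarith
    · have := inter_gap C J hJ z b a hb ha hl hne.symm
      linarith
end
end

section
/- k-Gibbs sampler reaches the mode fast: Consider the Markov chain (X^{(t)}) on {−1,1}^N in which at each step a subset K ⊆ [N] of size k is chosen uniformly at random and X_K is resampled from the conditional p_G(· | X_{−K}). Assume |C_G| ≤ k ≤ N, Σ_{i∈C_G} h_i = h_G > Σ_{i∉C_G} |h_i|, and J − ‖h‖₁ ≥ J₀ > 0. Define c_{R₁} := 1 − ( C(N−|C_G|, k−|C_G|) / C(N,k) ) · e^{2(J₀+h_G)} / ( e^{2(J₀+h_G)} + e^{2J₀} + 2^{|C_G|} − 2 ). Then for every initial state X^{(0)} and every T ∈ ℕ, the probability that X^{(t)} ∉ R₁ for all t ∈ [T] is at most c_{R₁}^T; in particular, for any δ ∈ (0,1), if T ≥ log_{c_{R₁}} δ, then with probability at least 1 − δ there exists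 t ∈ [T] with X^{(t)} ∈ R₁. -/
open scoped Classical BigOperators

noncomputable section

/-- The transition matrix of the `k`-Gibbs sampler for the Ising model: pick a uniformly
random subset `K ⊆ [N]` of size `k` and resample the coordinates in `K` jointly from the
conditional distribution `p_G(· | x_{-K})`. -/
def gibbsKernel {N : ℕ} (C : Finset (Fin N)) (J : ℝ) (h : Fin N → ℝ) (k : ℕ) :
    Matrix (Fin N → Bool) (Fin N → Bool) ℝ :=
  Matrix.of fun x y =>
    ∑ K ∈ Finset.univ.filter (fun K : Finset (Fin N) => K.card = k),
      ((1 : ℝ) / (N.choose k)) *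
        ((if ∀ i ∉ K, y i = x i then Real.exp (isingEnergy C J h y) else 0)
          / ∑ z : Fin N → Bool,
              (if ∀ i ∉ K, z i = x i then Real.exp (isingEnergy C J h z) else 0))

lemma spin_true' : spin true = 1 := by simp [spin]
lemma spin_false' : spin false = -1 := by simp [spin]

def gW {N : ℕ} (C : Finset (Fin N)) (J : ℝ) (h : Fin N → ℝ) (K : Finset (Fin N))
    (x y : Fin N → Bool) : ℝ :=
  if ∀ i ∉ K, y i = x i then Real.exp (isingEnergy C J h y) else 0

lemma gW_nonneg {N : ℕ} (C : Finset (Fin N)) (J : ℝ) (h : Fin N → ℝ) (K : Finset (Fin N))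
    (x y : Fin N → Bool) : 0 ≤ gW C J h K x y := by
  unfold gW; split_ifs <;> positivity

lemma gZ_pos {N : ℕ} (C : Finset (Fin N)) (J : ℝ) (h : Fin N → ℝ) (K : Finset (Fin N))
    (x : Fin N → Bool) : 0 < ∑ z, gW C J h K x z := by
  apply Finset.sum_pos'
  · intro z _; exact gW_nonneg ..
  · exact ⟨x, Finset.mem_univ _, by simp [gW, Real.exp_pos]⟩

def gflip {N : ℕ} (y : Fin N → Bool) (A : Finset (Fin N)) : Fin N → Bool :=
  fun i => if i ∈ A then false else y i

lemma field_flip {N : ℕ} (C : Finset (Fin N)) (h : Fin N → ℝ)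
    (y : Fin N → Bool) (hy : ∀ i ∈ C, y i = true) (A : Finset (Fin N)) (hA : A ⊆ C) :
    ∑ i, h i * spin (gflip y A i) = ∑ i, h i * spin (y i) - 2 * ∑ i ∈ A, h i := by
  have : ∑ i ∈ A, h i = ∑ i, if i ∈ A then h i else 0 := by simp
  rw [this, Finset.mul_sum, ← Finset.sum_sub_distrib]
  apply Finset.sum_congr rfl
  intro i _
  by_cases hi : i ∈ A
  · simp [gflip, hi, hy i (hA hi), spin]; ring
  · simp [gflip, hi]

lemma energy_full {N : ℕ} (C : Finset (Fin N)) (J : ℝ) (h : Fin N → ℝ)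
    (y : Fin N → Bool) (hy : ∀ i ∈ C, y i = true) :
    isingEnergy C J h (gflip y C) = isingEnergy C J h y - 2 * ∑ i ∈ C, h i := by
  unfold isingEnergy
  rw [field_flip C h y hy C subset_rfl]
  have : ∑ i ∈ C, ∑ j ∈ C, (if i < j then J * spin (gflip y C i) * spin (gflip y C j) else 0)
      = ∑ i ∈ C, ∑ j ∈ C, (if i < j then J * spin (y i) * spin (y j) else 0) := by
    refine Finset.sum_congr rfl fun i hi => Finset.sum_congr rfl fun j hj => ?_
    simp [gflip, hi, hj, hy i hi, hy j hj, spin]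
  rw [this]; ring

lemma energy_mixed {N : ℕ} (C : Finset (Fin N)) (J : ℝ) (hJ : 0 < J) (h : Fin N → ℝ)
    (y : Fin N → Bool) (hy : ∀ i ∈ C, y i = true) (A : Finset (Fin N)) (hA : A ⊆ C)
    (h0 : A ≠ ∅) (h1 : A ≠ C) :
    isingEnergy C J h (gflip y A) ≤ isingEnergy C J h y - 2 * ∑ i ∈ A, h i - 2 * J := by
  unfold isingEnergy
  rw [field_flip C h y hy A hA]
  obtain ⟨a, ha⟩ := Finset.nonempty_iff_ne_empty.2 h0
  obtain ⟨b, hb, hbA⟩ : ∃ b ∈ C, b ∉ A := by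
    by_contra hcon
    push Not at hcon
    exact h1 (Finset.Subset.antisymm hA hcon)
  have hab : a ≠ b := fun e => hbA (e ▸ ha)
  obtain ⟨p, q, hp, hq, hpq, hx⟩ : ∃ p q, p ∈ C ∧ q ∈ C ∧ p < q ∧
      spin (gflip y A p) * spin (gflip y A q) = -1 := by
    rcases lt_or_gt_of_ne hab with hl | hl
    · exact ⟨a, b, hA ha, hb, hl, by simp [gflip, ha, hbA, hy b hb, spin]⟩
    · exact ⟨b, a, hb, hA ha, hl, by simp [gflip, ha, hbA, hy b hb, spin]⟩
  have key : ∑ i ∈ C, ∑ j ∈ C, (if i < j then J * spin (gflip y A i) * spin (gflip y A j) else 0)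
      ≤ ∑ i ∈ C, ∑ j ∈ C, ((if i < j then J * spin (y i) * spin (y j) else 0)
        + (if i = p then (if j = q then -2 * J else 0) else 0)) := by
    refine Finset.sum_le_sum fun i hi => Finset.sum_le_sum fun j hj => ?_
    by_cases hij : i < j
    · rw [if_pos hij, if_pos hij, hy i hi, hy j hj, spin_true']
      by_cases he : i = p ∧ j = q
      · obtain ⟨rfl, rfl⟩ := he
        rw [mul_assoc, hx]; simp; linarith
      · have : (if i = p then (if j = q then -2 * J else 0) else 0) = 0 := by
          split_ifs <;> simp_all
        rw [this]
        unfold spin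
        split_ifs <;> linarith
    · have : ¬ (i = p ∧ j = q) := by rintro ⟨rfl, rfl⟩; exact hij hpq
      have : (if i = p then (if j = q then -2 * J else 0) else 0) = 0 := by
        split_ifs <;> simp_all
      rw [this]; simp [hij]
  have hs : ∑ i ∈ C, ∑ j ∈ C, (if i = p then (if j = q then -2 * J else 0) else 0) = -2 * J := by
    rw [Finset.sum_eq_single p]
    · simp [hq]
    · intro i _ hi; simp [hi]
    · intro hh; exact absurd hp hh
  simp only [Finset.sum_add_distrib] at key
  rw [hs] at key
  linarith

def gr {N : ℕ} (C : Finset (Fin N)) (a b : ℝ) (A : Finset (Fin N)) : ℝ :=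
  if A = ∅ then 1 else if A = C then a else b

lemma gr_sum {N : ℕ} (C : Finset (Fin N)) (hC : 2 ≤ C.card) (a b : ℝ) :
    ∑ A ∈ C.powerset, gr C a b A = 1 + a + (2 ^ C.card - 2) * b := by
  have hne : C ≠ ∅ := by rintro rfl; simp at hC
  have : ∀ A ∈ C.powerset, gr C a b A =
      b + ((if A = ∅ then 1 - b else 0) + (if A = C then a - b else 0)) := by
    intro A _
    unfold gr
    split_ifs with h1 h2
    · exact absurd (h2.symm.trans h1) hne
    all_goals ring
  rw [Finset.sum_congr rfl this, Finset.sum_add_distrib, Finset.sum_add_distrib]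
  simp
  ring

lemma sum_flip {N : ℕ} (C : Finset (Fin N)) (f : (Fin N → Bool) → ℝ) :
    ∑ z, f z = ∑ y ∈ Finset.univ.filter (fun y : Fin N → Bool => ∀ i ∈ C, y i = true),
      ∑ A ∈ C.powerset, f (gflip y A) := by
  rw [← Finset.sum_product']
  refine Finset.sum_nbij' (fun z => ((fun i => if i ∈ C then true else z i),
    C.filter (fun i => z i = false))) (fun p => gflip p.1 p.2) ?_ ?_ ?_ ?_ ?_
  · intro z _
    simp
    intro i hi; simp [hi]
  · intro p _; simp
  · intro z _
    funext i
    by_cases hi : i ∈ C <;> cases hz : z i <;> simp [gflip, hi, hz]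
  · rintro ⟨y, A⟩ hp
    simp at hp
    obtain ⟨hy, hA⟩ := hp
    ext i
    · by_cases hi : i ∈ C
      · simp [hi, hy]
      · have : i ∉ A := fun hh => hi (hA hh)
        simp [hi, gflip, this]
    · by_cases hi : i ∈ C
      · simp [hi, gflip, hy]
      · have : i ∉ A := fun hh => hi (hA hh)
        simp [hi, this]
  · intro z _
    congr 1
    funext i
    by_cases hi : i ∈ C <;> cases hz : z i <;> simp [gflip, hi, hz]

lemma Z_le {N : ℕ} (C : Finset (Fin N)) (hC : 2 ≤ C.card)
    (J J₀ : ℝ) (hJ : 0 < J) (h : Fin N → ℝ) (hgap : J₀ ≤ J - ∑ i, |h i|)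
    (hG : ℝ) (hhG : hG = ∑ i ∈ C, h i) (K : Finset (Fin N)) (hK : C ⊆ K) (x : Fin N → Bool) :
    ∑ z, gW C J h K x z ≤
      (1 + Real.exp (-2 * hG) + (2 ^ C.card - 2) * Real.exp (-2 * (J₀ + hG))) *
      ∑ y ∈ Finset.univ.filter (fun y : Fin N → Bool => ∀ i ∈ C, y i = true), gW C J h K x y := by
  rw [sum_flip C, Finset.mul_sum, ← gr_sum C hC]
  refine Finset.sum_le_sum fun y hy => ?_
  rw [Finset.sum_mul]
  refine Finset.sum_le_sum fun A hA => ?_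
  simp only [Finset.mem_filter, Finset.mem_univ, true_and] at hy
  rw [Finset.mem_powerset] at hA
  have hiff : (∀ i ∉ K, gflip y A i = x i) ↔ (∀ i ∉ K, y i = x i) := by
    refine forall_congr' fun i => imp_congr_right fun hi => ?_
    have : i ∉ A := fun hh => hi (hK (hA hh))
    simp [gflip, this]
  unfold gW
  by_cases hx : ∀ i ∉ K, y i = x i
  · rw [if_pos hx, if_pos (hiff.2 hx)]
    unfold gr
    split_ifs with h1 h2
    · subst h1
      have : gflip y ∅ = y := by funext i; simp [gflip]
      rw [this, one_mul]
    · subst h2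
      rw [energy_full _ J h y hy, ← Real.exp_add, ← hhG]
      apply Real.exp_le_exp.2; linarith
    · rw [← Real.exp_add]
      apply Real.exp_le_exp.2
      have := energy_mixed C J hJ h y hy A hA h1 h2
      have e : ∑ i ∈ C \ A, h i + ∑ i ∈ A, h i = ∑ i ∈ C, h i := Finset.sum_sdiff hA
      have e2 : ∑ i ∈ C \ A, h i ≤ ∑ i, |h i| :=
        (Finset.sum_le_sum fun i _ => le_abs_self (h i)).trans
          (Finset.sum_le_sum_of_subset_of_nonneg (Finset.subset_univ _)
            fun i _ _ => abs_nonneg _)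
      linarith
  · rw [if_neg hx, if_neg (fun hh => hx (hiff.1 hh))]; simp

lemma card_super {N : ℕ} (C : Finset (Fin N)) (k : ℕ) (hkC : C.card ≤ k) :
    ((Finset.univ.filter (fun K : Finset (Fin N) => K.card = k)).filter (fun K => C ⊆ K)).card
      = (N - C.card).choose (k - C.card) := by
  have : (Finset.powersetCard (k - C.card) (Cᶜ)).card = (N - C.card).choose (k - C.card) := by
    rw [Finset.card_powersetCard, Finset.card_compl, Fintype.card_fin]
  rw [← this]
  refine Finset.card_nbij' (fun K => K \ C) (fun K => K ∪ C) ?_ ?_ ?_ ?_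
  · intro K hK
    simp at hK
    simp only [Finset.mem_coe, Finset.mem_powersetCard]
    refine ⟨fun i hi => ?_, ?_⟩
    · simp at hi ⊢; exact hi.2
    · rw [Finset.card_sdiff_of_subset hK.2, hK.1]
  · intro K hK
    simp only [Finset.mem_coe, Finset.mem_powersetCard] at hK
    have hd : Disjoint K C := by
      rw [Finset.disjoint_left]; intro i hi; simpa using hK.1 hi
    simp [Finset.card_union_of_disjoint hd, hK.2]
    omega
  · intro K hK
    simp at hK
    exact Finset.sdiff_union_of_subset hK.2
  · intro K hK
    simp only [Finset.mem_coe, Finset.mem_powersetCard] at hK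
    have hd : Disjoint K C := by
      rw [Finset.disjoint_left]; intro i hi; simpa using hK.1 hi
    exact Finset.union_sdiff_cancel_right hd

lemma one_step {N : ℕ} (C : Finset (Fin N)) (hC : 2 ≤ C.card)
    (k : ℕ) (hkC : C.card ≤ k) (hkN : k ≤ N)
    (J J₀ : ℝ) (hJ : 0 < J) (h : Fin N → ℝ) (hgap : J₀ ≤ J - ∑ i, |h i|)
    (hG : ℝ) (hhG : hG = ∑ i ∈ C, h i) (x : Fin N → Bool) :
    ∑ y, (if ∀ i ∈ C, y i = true then 0 else gibbsKernel C J h k x y) ≤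
     1 - (((N - C.card).choose (k - C.card) : ℝ) / (N.choose k)) *
      (1 / (1 + Real.exp (-2 * hG) + (2 ^ C.card - 2) * Real.exp (-2 * (J₀ + hG)))) := by
  set D := 1 + Real.exp (-2 * hG) + (2 ^ C.card - 2) * Real.exp (-2 * (J₀ + hG)) with hD
  have h2 : (2:ℝ) ≤ 2 ^ C.card := by
    calc (2:ℝ) = 2 ^ 1 := by norm_num
      _ ≤ 2 ^ C.card := pow_le_pow_right₀ (by norm_num) (by omega)
  have hDpos : 0 < D := by
    have : 0 ≤ (2 ^ C.card - 2) * Real.exp (-2 * (J₀ + hG)) :=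
      mul_nonneg (by linarith) (Real.exp_pos _).le
    have := Real.exp_pos (-2 * hG)
    linarith
  have hch : (0:ℝ) < N.choose k := by exact_mod_cast Nat.choose_pos hkN
  have e1 : ∑ y, (if ∀ i ∈ C, y i = true then 0 else gibbsKernel C J h k x y)
      = ∑ K ∈ Finset.univ.filter (fun K : Finset (Fin N) => K.card = k),
        ((1 : ℝ) / (N.choose k)) *
          (1 - (∑ y ∈ Finset.univ.filter (fun y : Fin N → Bool => ∀ i ∈ C, y i = true),
            gW C J h K x y) / ∑ z, gW C J h K x z) := by
    have : ∀ y, (if ∀ i ∈ C, y i = true then 0 else gibbsKernel C J h k x y) =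
        ∑ K ∈ Finset.univ.filter (fun K : Finset (Fin N) => K.card = k),
        ((1 : ℝ) / (N.choose k)) * ((if ∀ i ∈ C, y i = true then 0 else gW C J h K x y)
          / ∑ z, gW C J h K x z) := by
      intro y
      split_ifs
      · simp
      · rfl
    simp_rw [this]
    rw [Finset.sum_comm]
    refine Finset.sum_congr rfl fun K _ => ?_
    rw [← Finset.mul_sum, ← Finset.sum_div]
    congr 1
    have hZ := gZ_pos C J h K x
    rw [eq_sub_iff_add_eq, ← add_div, div_eq_one_iff_eq hZ.ne', Finset.sum_filter,
      ← Finset.sum_add_distrib]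
    refine Finset.sum_congr rfl fun y _ => ?_
    split_ifs <;> simp
  rw [e1]
  calc _ ≤ ∑ K ∈ Finset.univ.filter (fun K : Finset (Fin N) => K.card = k),
        ((1 : ℝ) / (N.choose k)) * (1 - if C ⊆ K then 1 / D else 0) := by
        refine Finset.sum_le_sum fun K _ => ?_
        refine mul_le_mul_of_nonneg_left ?_ (by positivity)
        have hZ := gZ_pos C J h K x
        apply sub_le_sub_left
        split_ifs with hK
        · rw [div_le_div_iff₀ hDpos hZ]
          have := Z_le C hC J J₀ hJ h hgap hG hhG K hK x
          rw [← hD] at this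
          linarith
        · exact div_nonneg (Finset.sum_nonneg fun y _ => gW_nonneg ..) hZ.le
    _ = _ := by
        rw [← Finset.mul_sum, Finset.sum_sub_distrib, ← Finset.sum_filter, Finset.sum_const,
          Finset.sum_const, card_super C k hkC]
        have : (Finset.univ.filter (fun K : Finset (Fin N) => K.card = k)).card = N.choose k := by
          have := Finset.card_powersetCard k (Finset.univ : Finset (Fin N))
          rw [← Finset.univ_filter_card_eq] at this
          simpa using this
        rw [this]
        simp only [nsmul_eq_mul]
        field_simp

lemma const_eq (n : ℕ) (hn : 2 ≤ n) (J₀ g : ℝ) :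
    Real.exp (2 * (J₀ + g)) / (Real.exp (2 * (J₀ + g)) + Real.exp (2 * J₀) + 2 ^ n - 2)
    = 1 / (1 + Real.exp (-2 * g) + (2 ^ n - 2) * Real.exp (-2 * (J₀ + g))) := by
  have h2 : (2:ℝ) ≤ 2 ^ n := by
    calc (2:ℝ) = 2 ^ 1 := by norm_num
      _ ≤ 2 ^ n := pow_le_pow_right₀ (by norm_num) (by omega)
  have p1 := Real.exp_pos (2 * (J₀ + g))
  have p2 := Real.exp_pos (2 * J₀)
  have p3 := Real.exp_pos (-2 * g)
  have p4 := Real.exp_pos (-2 * (J₀ + g))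
  have e1 : Real.exp (2 * (J₀ + g)) * Real.exp (-2 * g) = Real.exp (2 * J₀) := by
    rw [← Real.exp_add]; ring_nf
  have e2 : Real.exp (2 * (J₀ + g)) * Real.exp (-2 * (J₀ + g)) = 1 := by
    rw [← Real.exp_add]; ring_nf; simp
  have : 0 ≤ (2 ^ n - 2) * Real.exp (-2 * (J₀ + g)) := mul_nonneg (by linarith) p4.le
  rw [div_eq_div_iff (by linarith) (by linarith), mul_add, mul_add, e1,
    mul_left_comm, e2]
  ring

/-- **The `k`-Gibbs sampler reaches the mode fast.**
Assume `|C| ≤ k ≤ N`, `h_G = Σ_{i∈C} h_i > Σ_{i∉C} |h_i|`, and `J - ‖h‖₁ ≥ J₀ > 0`.  Let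
`Q` be the sub-stochastic kernel obtained from the `k`-Gibbs transition matrix by killing
the chain upon entering `R₁ = {x : x_i = 1 ∀ i ∈ C}`, so that `Σ_y Q^T x₀ y` is the
probability that, started at `x₀`, the chain avoids `R₁` at all times `t ∈ [T]`.  With
`c_{R₁}` as defined below, this probability is at most `c_{R₁}^T`; in particular, for
`δ ∈ (0,1)` and `T ≥ log_{c_{R₁}} δ`, with probability at least `1 - δ` the chain visits
`R₁` within `T` steps. -/
theorem k_gibbs_reaches_mode_fast
    {N : ℕ} (C : Finset (Fin N)) (hC : 2 ≤ C.card)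
    (k : ℕ) (hkC : C.card ≤ k) (hkN : k ≤ N)
    (J J₀ : ℝ) (hJ : 0 < J) (h : Fin N → ℝ)
    (hfield : ∑ i ∈ Finset.univ \ C, |h i| < ∑ i ∈ C, h i)
    (hJ₀ : 0 < J₀) (hgap : J₀ ≤ J - ∑ i, |h i|)
    -- h_G and the constant c_{R₁}
    (hG : ℝ) (hhG : hG = ∑ i ∈ C, h i)
    (c : ℝ)
    (hc : c = 1 - (((N - C.card).choose (k - C.card) : ℝ) / (N.choose k))
        * (Real.exp (2 * (J₀ + hG))
            / (Real.exp (2 * (J₀ + hG)) + Real.exp (2 * J₀)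
                + 2 ^ C.card - 2)))
    -- the killed (sub-stochastic) kernel
    (Q : Matrix (Fin N → Bool) (Fin N → Bool) ℝ)
    (hQ : Q = Matrix.of fun x y =>
      if ∀ i ∈ C, y i = true then 0 else gibbsKernel C J h k x y) :
    -- survival (mode-avoidance) probability decays geometrically
    (∀ (x₀ : Fin N → Bool) (T : ℕ), ∑ y : Fin N → Bool, (Q ^ T) x₀ y ≤ c ^ T)
    ∧
    -- in particular, after T ≥ log_c δ steps the mode has been reached w.p. ≥ 1 - δ
    (∀ (δ : ℝ), 0 < δ → δ < 1 → ∀ (T : ℕ), Real.logb c δ ≤ (T : ℝ) →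
      ∀ x₀ : Fin N → Bool, ∑ y : Fin N → Bool, (Q ^ T) x₀ y ≤ δ) := by
  have h2 : (2:ℝ) ≤ 2 ^ C.card := by
    calc (2:ℝ) = 2 ^ 1 := by norm_num
      _ ≤ 2 ^ C.card := pow_le_pow_right₀ (by norm_num) (by omega)
  have hch : (0:ℝ) < N.choose k := by exact_mod_cast Nat.choose_pos hkN
  have hch1 : (0:ℝ) < (N - C.card).choose (k - C.card) := by
    exact_mod_cast Nat.choose_pos (by omega)
  have hle : (((N - C.card).choose (k - C.card) : ℕ) : ℝ) ≤ N.choose k := by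
    have e : (Finset.univ.filter (fun K : Finset (Fin N) => K.card = k)).card = N.choose k := by
      have := Finset.card_powersetCard k (Finset.univ : Finset (Fin N))
      rw [← Finset.univ_filter_card_eq] at this
      simpa using this
    rw [← card_super C k hkC, ← e]
    exact_mod_cast Finset.card_filter_le _ _
  have hp1 := Real.exp_pos (2 * (J₀ + hG))
  have hp2 := Real.exp_pos (2 * J₀)
  set r := Real.exp (2 * (J₀ + hG)) / (Real.exp (2 * (J₀ + hG)) + Real.exp (2 * J₀)
                + 2 ^ C.card - 2) with hr
  have hr0 : 0 < r := div_pos hp1 (by linarith)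
  have hr1 : r < 1 := by rw [hr, div_lt_one (by linarith)]; linarith
  set m := (((N - C.card).choose (k - C.card) : ℕ) : ℝ) / (N.choose k) with hm
  have hm0 : 0 < m := div_pos hch1 hch
  have hm1 : m ≤ 1 := by rw [hm, div_le_one hch]; exact hle
  have hc0 : 0 < c := by
    have : m * r < 1 := by nlinarith
    rw [hc]; linarith
  have hc1 : c < 1 := by
    have := mul_pos hm0 hr0
    rw [hc]; linarith
  have hstep : ∀ x, ∑ y, Q x y ≤ c := by
    intro x
    rw [hc, hr, const_eq C.card hC J₀ hG, hQ]
    exact one_step C hC k hkC hkN J J₀ hJ h hgap hG hhG x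
  have hQ0 : ∀ x y, 0 ≤ Q x y := by
    intro x y
    rw [hQ]
    simp only [Matrix.of_apply]
    split_ifs
    · exact le_rfl
    · unfold gibbsKernel
      simp only [Matrix.of_apply]
      refine Finset.sum_nonneg fun K _ => mul_nonneg (by positivity) ?_
      exact div_nonneg (gW_nonneg C J h K x y) (gZ_pos C J h K x).le
  have main : ∀ (T : ℕ) (x₀ : Fin N → Bool), ∑ y : Fin N → Bool, (Q ^ T) x₀ y ≤ c ^ T := by
    intro T
    induction T with
    | zero => intro x; simp [Matrix.one_apply]
    | succ T ih =>
      intro x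
      rw [pow_succ' Q]
      simp only [Matrix.mul_apply]
      rw [Finset.sum_comm]
      simp only [← Finset.mul_sum]
      calc _ ≤ ∑ z, Q x z * c ^ T :=
            Finset.sum_le_sum fun z _ => mul_le_mul_of_nonneg_left (ih z) (hQ0 x z)
        _ = (∑ z, Q x z) * c ^ T := by rw [Finset.sum_mul]
        _ ≤ c * c ^ T := mul_le_mul_of_nonneg_right (hstep x) (by positivity)
        _ = c ^ (T + 1) := by ring
  refine ⟨fun x T => main T x, fun δ hδ0 hδ1 T hT x => (main T x).trans ?_⟩
  have hlc : Real.log c < 0 := Real.log_neg hc0 hc1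
  unfold Real.logb at hT
  rw [div_le_iff_of_neg hlc] at hT
  rw [← Real.log_le_log_iff (by positivity) hδ0, Real.log_pow]
  exact hT
end
end
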